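/- arXiv:1701.03823 — 10 statements merged into one kernel-verified Lean document; each statement's English description precedes it below -/
import Mathlib

section
/- Let U be an open subset of ℂⁿ and let f : U → ℝ be twice continuously differentiable. Then the following are equivalent: (i) there exists a strictly positive function φ ∈ C^∞(U, ℝ) such that L_f(a)(b,b) ≥ φ(a)·‖b‖² for all a ∈ U and all b ∈ ℂⁿ; (ii) there exists a strictly positive function φ ∈ C^∞(U, ℝ) such that for every a ∈ U there is δ > 0 with (1/(2π))∫₀^{2π} (f(a + e^{iθ}b) − f(a)) dθ ≥ φ(a)·‖b‖² for all b ∈ ℂⁿ with ‖b‖ ≤ δ. -/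
open MeasureTheory

/-- The Levi form of a real-valued function `f` at `a` in direction `b`:
`L_f(a)(b,b) = (1/4)(D²f(a)(b,b) + D²f(a)(ib,ib))`, where `D²f(a)` is the second real
Fréchet derivative of `f` at `a`. -/
noncomputable def leviForm {E : Type*} [NormedAddCommGroup E] [NormedSpace ℂ E]
    (f : E → ℝ) (a b : E) : ℝ :=
  (1 / 4) * (iteratedFDeriv ℝ 2 f a ![b, b] +
    iteratedFDeriv ℝ 2 f a ![Complex.I • b, Complex.I • b])

/-- Second-order Taylor expansion with Peano remainder for a function that is `C²` at a point. -/
lemma ContDiffAt.exists_taylor_two_remainder_le {E : Type*} [NormedAddCommGroup E]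
    [NormedSpace ℝ E] {f : E → ℝ} {a : E} (hf : ContDiffAt ℝ 2 f a) {ε : ℝ} (hε : 0 < ε) :
    ∃ δ > 0, ∀ h : E, ‖h‖ ≤ δ →
      |f (a + h) - f a - fderiv ℝ f a h - (1 / 2) * fderiv ℝ (fderiv ℝ f) a h h|
        ≤ ε * ‖h‖ ^ 2 := by
  set B := fderiv ℝ (fderiv ℝ f) a
  have hsymm : ∀ x y, B x y = B y x :=
    hf.isSymmSndFDerivAt (by simp)
  have hd1 : ∀ᶠ x in nhds a, DifferentiableAt ℝ f x := by
    filter_upwards [hf.eventually (by simp)] with x hx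
    exact hx.differentiableAt (by simp)
  have hd2 : DifferentiableAt ℝ (fderiv ℝ f) a :=
    (hf.fderiv_right (m := 1) (by norm_num)).differentiableAt (by simp)
  have hd3 := hd2.hasFDerivAt.isLittleO.def hε
  obtain ⟨r, hr, hball⟩ := Metric.eventually_nhds_iff_ball.1 (hd1.and hd3)
  refine ⟨r / 2, by positivity, fun h hh => ?_⟩
  set g : E → ℝ := fun x => f x - fderiv ℝ f a (x - a) - (1 / 2) * B (x - a) (x - a) with hg
  have hmem : ∀ x ∈ Metric.closedBall a ‖h‖, x ∈ Metric.ball a r := fun x hx => by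
    rw [Metric.mem_closedBall] at hx
    rw [Metric.mem_ball]
    linarith
  have hderiv : ∀ x ∈ Metric.closedBall a ‖h‖, HasFDerivWithinAt g
      (fderiv ℝ f x - fderiv ℝ f a - B (x - a)) (Metric.closedBall a ‖h‖) x := fun x hx => by
    have hx' := (hball x (hmem x hx)).1.hasFDerivAt
    have hs : HasFDerivAt (fun y : E => y - a) (ContinuousLinearMap.id ℝ E) x :=
      (hasFDerivAt_id x).sub_const a
    have h1 := (fderiv ℝ f a).hasFDerivAt.comp x hs
    have h2 := (B.hasFDerivAt.comp x hs).clm_apply hs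
    refine (((hx'.sub h1).sub (h2.const_mul (1 / 2))).congr_fderiv ?_).hasFDerivWithinAt
    ext y
    have := hsymm (x - a) y
    simp only [map_sub, sub_apply] at this
    simp
    linarith
  have hbound : ∀ x ∈ Metric.closedBall a ‖h‖,
      ‖fderiv ℝ f x - fderiv ℝ f a - B (x - a)‖ ≤ ε * ‖h‖ := fun x hx => by
    refine (hball x (hmem x hx)).2.trans ?_
    gcongr
    simpa [dist_eq_norm] using hx
  have := (convex_closedBall a ‖h‖).norm_image_sub_le_of_norm_hasFDerivWithin_le hderiv hbound
    (x := a) (y := a + h) (by simp) (by simp)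
  simp only [hg, sub_self, map_zero, add_sub_cancel_left, Real.norm_eq_abs, mul_zero,
    sub_zero] at this
  calc _ = _ := by congr 1; ring
    _ ≤ _ := this
    _ = _ := by ring

lemma exp_mul_I_smul_eq {E : Type*} [NormedAddCommGroup E] [NormedSpace ℂ E] (θ : ℝ) (b : E) :
    Complex.exp (θ * Complex.I) • b = Real.cos θ • b + Real.sin θ • (Complex.I • b) := by
  rw [Complex.exp_mul_I, add_smul, mul_smul, ← Complex.ofReal_cos, ← Complex.ofReal_sin,
    Complex.coe_smul, Complex.coe_smul]

/-- The circle mean of the quadratic Taylor polynomial of `f` is the Levi form. -/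
lemma integral_taylor_two_circle_eq_leviForm {E : Type*} [NormedAddCommGroup E] [NormedSpace ℂ E]
    (f : E → ℝ) (a b : E) :
    ∫ θ in (0 : ℝ)..(2 * Real.pi), (fderiv ℝ f a (Complex.exp (θ * Complex.I) • b) +
      (1 / 2) * fderiv ℝ (fderiv ℝ f) a (Complex.exp (θ * Complex.I) • b)
        (Complex.exp (θ * Complex.I) • b)) = 2 * Real.pi * leviForm f a b := by
  set L := fderiv ℝ f a
  set B := fderiv ℝ (fderiv ℝ f) a
  have hexpand : ∀ θ : ℝ, L (Complex.exp (θ * Complex.I) • b) +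
      (1 / 2) * B (Complex.exp (θ * Complex.I) • b) (Complex.exp (θ * Complex.I) • b) =
      Real.cos θ * L b + Real.sin θ * L (Complex.I • b) +
      Real.cos θ ^ 2 * ((1 / 2) * B b b) +
      Real.sin θ * Real.cos θ * ((1 / 2) * (B b (Complex.I • b) + B (Complex.I • b) b)) +
      Real.sin θ ^ 2 * ((1 / 2) * B (Complex.I • b) (Complex.I • b)) := fun θ => by
    rw [exp_mul_I_smul_eq]
    simp only [map_add, map_smul, add_apply, smul_apply,
      smul_eq_mul]
    ring
  simp only [hexpand]
  rw [intervalIntegral.integral_add, intervalIntegral.integral_add, intervalIntegral.integral_add,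
    intervalIntegral.integral_add]
  · simp only [intervalIntegral.integral_mul_const, integral_cos, integral_sin, integral_cos_sq,
      integral_sin_sq, integral_sin_mul_cos₁, leviForm, iteratedFDeriv_two_apply]
    simp [L, B]
    ring
  all_goals exact Continuous.intervalIntegrable (by fun_prop) _ _

/-- The circle mean increment of a `C²` function agrees with its Levi form to second order. -/
lemma ContDiffOn.exists_circle_mean_sub_leviForm_le {E : Type*} [NormedAddCommGroup E]
    [NormedSpace ℂ E] {U : Set E} (hU : IsOpen U) {f : E → ℝ} (hf : ContDiffOn ℝ 2 f U)
    {a : E} (ha : a ∈ U) {ε : ℝ} (hε : 0 < ε) :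
    ∃ δ > 0, Metric.closedBall a δ ⊆ U ∧ ∀ b : E, ‖b‖ ≤ δ →
      |(1 / (2 * Real.pi)) * (∫ θ in (0 : ℝ)..(2 * Real.pi),
        (f (a + Complex.exp (θ * Complex.I) • b) - f a)) - leviForm f a b| ≤ ε * ‖b‖ ^ 2 := by
  obtain ⟨δ₁, hδ₁, hT⟩ :=
    (hf.contDiffAt (hU.mem_nhds ha)).exists_taylor_two_remainder_le hε
  obtain ⟨δ₂, hδ₂, hsub⟩ := Metric.nhds_basis_closedBall.mem_iff.1 (hU.mem_nhds ha)
  refine ⟨min δ₁ δ₂, lt_min hδ₁ hδ₂,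
    (Metric.closedBall_subset_closedBall (min_le_right _ _)).trans hsub, fun b hb => ?_⟩
  have hnorm : ∀ θ : ℝ, ‖Complex.exp (θ * Complex.I) • b‖ = ‖b‖ := fun θ => by
    rw [norm_smul, Complex.norm_exp_ofReal_mul_I, one_mul]
  have hcont : Continuous fun θ : ℝ => f (a + Complex.exp (θ * Complex.I) • b) - f a := by
    refine (hf.continuousOn.comp_continuous (by fun_prop) fun θ => hsub ?_).sub continuous_const
    simpa [hnorm] using hb.trans (min_le_right _ _)
  have hbound := intervalIntegral.norm_integral_le_of_norm_le_const (a := 0) (b := 2 * Real.pi)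
    (C := ε * ‖b‖ ^ 2) (f := fun θ : ℝ => (f (a + Complex.exp (θ * Complex.I) • b) - f a) -
      (fderiv ℝ f a (Complex.exp (θ * Complex.I) • b) +
      (1 / 2) * fderiv ℝ (fderiv ℝ f) a (Complex.exp (θ * Complex.I) • b)
        (Complex.exp (θ * Complex.I) • b))) fun θ _ => by
    have := hT (Complex.exp (θ * Complex.I) • b) (by
      rw [hnorm]
      exact hb.trans (min_le_left _ _))
    rw [hnorm] at this
    rwa [Real.norm_eq_abs, ← sub_sub]
  rw [intervalIntegral.integral_sub (hcont.intervalIntegrable _ _)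
    (Continuous.intervalIntegrable (by fun_prop) _ _), integral_taylor_two_circle_eq_leviForm,
    Real.norm_eq_abs, sub_zero, abs_of_pos Real.two_pi_pos] at hbound
  have hpi := Real.two_pi_pos
  rw [← mul_le_mul_iff_left₀ hpi]
  refine le_of_eq_of_le ?_ hbound
  rw [← abs_of_pos hpi, ← abs_mul, abs_of_pos hpi]
  congr 1
  rw [sub_mul, mul_right_comm, one_div, inv_mul_cancel₀ hpi.ne', one_mul, mul_comm (leviForm f a b)]

lemma leviForm_smul {E : Type*} [NormedAddCommGroup E] [NormedSpace ℂ E]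
    (f : E → ℝ) (a b : E) (t : ℝ) : leviForm f a (t • b) = t ^ 2 * leviForm f a b := by
  simp only [leviForm, iteratedFDeriv_two_apply, smul_comm Complex.I t b]
  simp
  ring

/-- For a `C²` function `f` on an open set `U ⊆ ℂⁿ`, the existence of a strictly positive
`C^∞` function `φ` with `L_f(a)(b,b) ≥ φ(a)‖b‖²` everywhere is equivalent to the existence of
a strictly positive `C^∞` function `φ` such that, around each point `a ∈ U`, the circle-mean
increment of `f` is bounded below by `φ(a)‖b‖²` for all `b` of small norm. -/
theorem levi_bound_iff_average_bound {n : ℕ}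
    (U : Set (EuclideanSpace ℂ (Fin n))) (hU : IsOpen U)
    (f : EuclideanSpace ℂ (Fin n) → ℝ) (hf : ContDiffOn ℝ 2 f U) :
    (∃ φ : EuclideanSpace ℂ (Fin n) → ℝ, ContDiffOn ℝ (⊤ : ℕ∞) φ U ∧ (∀ a ∈ U, 0 < φ a) ∧
      ∀ a ∈ U, ∀ b : EuclideanSpace ℂ (Fin n), φ a * ‖b‖ ^ 2 ≤ leviForm f a b) ↔
    (∃ φ : EuclideanSpace ℂ (Fin n) → ℝ, ContDiffOn ℝ (⊤ : ℕ∞) φ U ∧ (∀ a ∈ U, 0 < φ a) ∧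
      ∀ a ∈ U, ∃ δ > 0, Metric.closedBall a δ ⊆ U ∧
        ∀ b : EuclideanSpace ℂ (Fin n), ‖b‖ ≤ δ →
          φ a * ‖b‖ ^ 2 ≤ (1 / (2 * Real.pi)) *
            ∫ θ in (0:ℝ)..(2 * Real.pi),
              (f (a + Complex.exp (θ * Complex.I) • b) - f a)) := by
  constructor
  · rintro ⟨φ, hφ, hpos, hL⟩
    refine ⟨fun a => φ a / 2, hφ.div_const 2, fun a ha => half_pos (hpos a ha), fun a ha => ?_⟩
    obtain ⟨δ, hδ, hsub, hmean⟩ :=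
      ContDiffOn.exists_circle_mean_sub_leviForm_le hU hf ha (half_pos (hpos a ha))
    refine ⟨δ, hδ, hsub, fun b hb => ?_⟩
    have h1 := (abs_le.1 (hmean b hb)).1
    have h2 := hL a ha b
    linarith
  · rintro ⟨φ, hφ, hpos, hM⟩
    refine ⟨φ, hφ, hpos, fun a ha b => ?_⟩
    obtain ⟨δ₁, hδ₁, -, hmean⟩ := hM a ha
    have key : ∀ ε > 0, φ a * ‖b‖ ^ 2 ≤ leviForm f a b + ε * ‖b‖ ^ 2 := fun ε hε => by
      obtain ⟨δ₂, hδ₂, -, happrox⟩ :=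
        ContDiffOn.exists_circle_mean_sub_leviForm_le hU hf ha hε
      have hδ : 0 < min δ₁ δ₂ := lt_min hδ₁ hδ₂
      set t : ℝ := min δ₁ δ₂ / (‖b‖ + 1) with ht
      have ht0 : 0 < t := by positivity
      have hnorm : ‖t • b‖ = t * ‖b‖ := by rw [norm_smul, Real.norm_of_nonneg ht0.le]
      have hle : ‖t • b‖ ≤ min δ₁ δ₂ := by
        rw [hnorm, ht, div_mul_eq_mul_div, div_le_iff₀ (by positivity)]
        gcongr
        linarith
      have h1 := hmean (t • b) (hle.trans (min_le_left _ _))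
      have h2 := (abs_le.1 (happrox (t • b) (hle.trans (min_le_right _ _)))).2
      rw [leviForm_smul, hnorm] at h2
      rw [hnorm] at h1
      refine le_of_mul_le_mul_left ?_ (pow_pos ht0 2)
      linarith
    rcases eq_or_ne b 0 with rfl | hb
    · simpa using key 1 one_pos
    · refine le_of_forall_pos_le_add fun η hη => ?_
      have hb2 : 0 < ‖b‖ ^ 2 := by positivity
      have hkey := key (η / ‖b‖ ^ 2) (by positivity)
      rwa [div_mul_cancel_of_imp fun h => absurd h hb2.ne'] at hkey
end

section
/- Let U ⊂ ℂⁿ be a bounded open set, V an open set containing the closure of U, and ρ ∈ C²(V, ℝ) with U = {z ∈ V : ρ(z) < 0}, ρ = 0 on ∂U, and Dρ(z) ≠ 0 for every z ∈ ∂U. Suppose there exists a strictly positive φ ∈ C^∞(U, ℝ) such that m := inf_{a ∈ U} φ(a)·|ρ(a)| > 0 and L_{−log|ρ|}(a)(b,b) ≥ φ(a)·‖b‖² for all a ∈ U and b ∈ ℂⁿ. Then: (i) for every a ∈ U and b ∈ ℂⁿ with D'ρ(a)(b) = 0 one has L_ρ(a)(b,b) ≥ m·‖b‖²; and (ii) for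 every a ∈ ∂U and every b ≠ 0 with D'ρ(a)(b) = 0 one has L_ρ(a)(b,b) > 0, i.e. U is strictly Levi pseudoconvex. -/
open MeasureTheory

/-- `D'f(a)(b) = (1/2)(Df(a)(b) − i·Df(a)(ib))`, where `Df(a)` is the real Fréchet
derivative of `f` at `a`. -/
noncomputable def Dprime {E : Type*} [NormedAddCommGroup E] [NormedSpace ℂ E]
    (f : E → ℝ) (a b : E) : ℂ :=
  (1 / 2) * ((fderiv ℝ f a b : ℂ) - Complex.I * (fderiv ℝ f a (Complex.I • b) : ℂ))

/-- The form `D'f(a)` is `ℂ`-linear. -/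
theorem Dprime_sub_smul {E : Type*} [NormedAddCommGroup E] [NormedSpace ℂ E]
    (f : E → ℝ) (a b v : E) (c : ℂ) :
    Dprime f a (b - c • v) = Dprime f a b - c * Dprime f a v := by
  have hc : c • v = c.re • v + c.im • (Complex.I • v) := by
    conv_lhs => rw [← Complex.re_add_im c]
    rw [add_smul, mul_smul, Complex.coe_smul, Complex.coe_smul]
  have hIc : Complex.I • c • v = c.re • (Complex.I • v) - c.im • v := by
    rw [hc, smul_add, smul_comm Complex.I c.re v, smul_comm Complex.I c.im (Complex.I • v),
      smul_smul Complex.I Complex.I v, Complex.I_mul_I, neg_one_smul, smul_neg, sub_eq_add_neg]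
  simp only [Dprime]
  rw [smul_sub, hIc, hc]
  simp only [map_sub, map_add, map_smul, smul_eq_mul]
  apply Complex.ext <;> simp <;> ring

theorem Dprime_eq_zero_iff {E : Type*} [NormedAddCommGroup E] [NormedSpace ℂ E]
    (f : E → ℝ) (a b : E) :
    Dprime f a b = 0 ↔ fderiv ℝ f a b = 0 ∧ fderiv ℝ f a (Complex.I • b) = 0 := by
  simp [Dprime, Complex.ext_iff]

/-- In a direction annihilated by `Df(a)`, the second derivative of `-log|f|` is that of `f`
scaled by `-1 / f(a)`. -/
theorem iteratedFDeriv_two_neg_log_abs {E : Type*} [NormedAddCommGroup E] [NormedSpace ℝ E]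
    {f : E → ℝ} {a v : E} (hf : ContDiffAt ℝ 2 f a) (ha : f a ≠ 0) (hv : fderiv ℝ f a v = 0) :
    iteratedFDeriv ℝ 2 (fun z => -Real.log |f z|) a ![v, v] =
      -(f a)⁻¹ * iteratedFDeriv ℝ 2 f a ![v, v] := by
  have hderiv : fderiv ℝ (fun z => -Real.log |f z|) =ᶠ[nhds a]
      fun z => (-(f z)⁻¹) • fderiv ℝ f z := by
    filter_upwards [hf.eventually (by simp), hf.continuousAt.eventually_ne ha] with z hz hz0
    have hd := ((hz.differentiableAt (by simp)).hasFDerivAt.log hz0).neg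
    simp only [Real.log_abs]
    rw [neg_smul]
    exact hd.fderiv
  have hfa : HasFDerivAt f (fderiv ℝ f a) a := (hf.differentiableAt (by simp)).hasFDerivAt
  have hffa : HasFDerivAt (fderiv ℝ f) (fderiv ℝ (fderiv ℝ f) a) a :=
    ((hf.fderiv_right (m := 1) (by norm_num)).differentiableAt (by simp)).hasFDerivAt
  have hinv : DifferentiableAt ℝ (fun z => -(f z)⁻¹) a := (hfa.differentiableAt.inv ha).neg
  rw [iteratedFDeriv_two_apply, iteratedFDeriv_two_apply, hderiv.fderiv_eq,
    (hinv.hasFDerivAt.fun_smul hffa).fderiv]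
  simp [hv]

theorem leviForm_neg_log_abs {E : Type*} [NormedAddCommGroup E] [NormedSpace ℂ E]
    {f : E → ℝ} {a b : E} (hf : ContDiffAt ℝ 2 f a) (ha : f a ≠ 0) (hb : Dprime f a b = 0) :
    leviForm (fun z => -Real.log |f z|) a b = -(f a)⁻¹ * leviForm f a b := by
  obtain ⟨h₁, h₂⟩ := (Dprime_eq_zero_iff f a b).1 hb
  simp only [leviForm]
  rw [iteratedFDeriv_two_neg_log_abs hf ha h₁, iteratedFDeriv_two_neg_log_abs hf ha h₂]
  ring

/-- The Levi form of a `C²` function is jointly continuous in the point and the direction. -/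
theorem ContDiffAt.continuousAt_leviForm {E : Type*} [NormedAddCommGroup E] [NormedSpace ℂ E]
    {f : E → ℝ} {a : E} (hf : ContDiffAt ℝ 2 f a) {β : E → E} (hβ : ContinuousAt β a) :
    ContinuousAt (fun z => leviForm f z (β z)) a := by
  have hff : ContinuousAt (fderiv ℝ (fderiv ℝ f)) a :=
    ((hf.fderiv_right (m := 1) (by norm_num)).fderiv_right (m := 0) (by norm_num)).continuousAt
  simp only [leviForm, iteratedFDeriv_two_apply, Matrix.cons_val_zero, Matrix.cons_val_one]
  have hIβ : ContinuousAt (fun z => Complex.I • β z) a := hβ.const_smul _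
  exact continuousAt_const.mul
    (((hff.clm_apply hβ).clm_apply hβ).add ((hff.clm_apply hIβ).clm_apply hIβ))

theorem ContDiffAt.continuousAt_Dprime {E : Type*} [NormedAddCommGroup E] [NormedSpace ℂ E]
    {f : E → ℝ} {a : E} (hf : ContDiffAt ℝ 2 f a) (b : E) :
    ContinuousAt (fun z => Dprime f z b) a := by
  have hff : ContinuousAt (fderiv ℝ f) a :=
    (hf.fderiv_right (m := 1) (by norm_num)).continuousAt
  have hcoe (v : E) : ContinuousAt (fun z => (fderiv ℝ f z v : ℂ)) a :=
    Complex.continuous_ofReal.continuousAt.comp (hff.clm_apply continuousAt_const)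
  exact continuousAt_const.mul ((hcoe b).sub (continuousAt_const.mul (hcoe _)))

/-- Where `Df(a) ≠ 0`, every vector in the kernel of `D'f(a)` extends to a field of vectors in the
kernels of `D'f(z)`, `z` near `a`, which is continuous at `a`. -/
theorem exists_continuousAt_Dprime_eq_zero {E : Type*} [NormedAddCommGroup E] [NormedSpace ℂ E]
    {f : E → ℝ} {a b : E} (hf : ContDiffAt ℝ 2 f a) (ha : fderiv ℝ f a ≠ 0)
    (hb : Dprime f a b = 0) :
    ∃ β : E → E, ContinuousAt β a ∧ β a = b ∧ ∀ᶠ z in nhds a, Dprime f z (β z) = 0 := by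
  obtain ⟨v, hv⟩ : ∃ v, fderiv ℝ f a v ≠ 0 := by
    by_contra! h
    exact ha (ContinuousLinearMap.ext h)
  have hDv : Dprime f a v ≠ 0 := fun h => hv ((Dprime_eq_zero_iff f a v).1 h).1
  refine ⟨fun z => b - (Dprime f z b / Dprime f z v) • v, ?_, by simp [hb], ?_⟩
  · exact continuousAt_const.sub
      (((hf.continuousAt_Dprime b).div (hf.continuousAt_Dprime v) hDv).smul continuousAt_const)
  · filter_upwards [(hf.continuousAt_Dprime v).eventually_ne hDv] with z hz
    rw [Dprime_sub_smul, div_mul_cancel₀ _ hz, sub_self]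

/-- If `−log|ρ|` satisfies a strict Levi-form lower bound `φ(a)‖b‖²` on `U` with
`inf_U φ·|ρ| ≥ m > 0`, then `ρ` satisfies `L_ρ(a)(b,b) ≥ m‖b‖²` on complex tangential
directions at interior points, and `U` is strictly Levi pseudoconvex at boundary points. -/
theorem strictly_Levi_pseudoconvex_of_log_levi_bound {n : ℕ}
    (U V : Set (EuclideanSpace ℂ (Fin n)))
    (hUb : Bornology.IsBounded U) (hUo : IsOpen U) (hVo : IsOpen V) (hUV : closure U ⊆ V)
    (ρ : EuclideanSpace ℂ (Fin n) → ℝ) (hρ : ContDiffOn ℝ 2 ρ V)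
    (hUdef : U = {z ∈ V | ρ z < 0})
    (hρ0 : ∀ z ∈ frontier U, ρ z = 0)
    (hDρ : ∀ z ∈ frontier U, fderiv ℝ ρ z ≠ 0)
    (φ : EuclideanSpace ℂ (Fin n) → ℝ)
    (hφ : ContDiffOn ℝ (⊤ : ℕ∞) φ U) (hφpos : ∀ a ∈ U, 0 < φ a)
    (m : ℝ) (hm : 0 < m) (hminf : ∀ a ∈ U, m ≤ φ a * |ρ a|)
    (hLevi : ∀ a ∈ U, ∀ b : EuclideanSpace ℂ (Fin n),
      φ a * ‖b‖ ^ 2 ≤ leviForm (fun z => -Real.log |ρ z|) a b) :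
    (∀ a ∈ U, ∀ b : EuclideanSpace ℂ (Fin n),
      Dprime ρ a b = 0 → m * ‖b‖ ^ 2 ≤ leviForm ρ a b) ∧
    (∀ a ∈ frontier U, ∀ b : EuclideanSpace ℂ (Fin n),
      b ≠ 0 → Dprime ρ a b = 0 → 0 < leviForm ρ a b) := by
  have hsmooth : ∀ a ∈ closure U, ContDiffAt ℝ 2 ρ a := fun a ha =>
    hρ.contDiffAt (hVo.mem_nhds (hUV ha))
  have hinterior : ∀ a ∈ U, ∀ b : EuclideanSpace ℂ (Fin n),
      Dprime ρ a b = 0 → m * ‖b‖ ^ 2 ≤ leviForm ρ a b := by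
    intro a ha b hb
    have hneg : ρ a < 0 := by
      rw [hUdef] at ha
      exact ha.2
    have hL := hLevi a ha b
    rw [leviForm_neg_log_abs (hsmooth a (subset_closure ha)) hneg.ne hb] at hL
    calc m * ‖b‖ ^ 2 ≤ φ a * |ρ a| * ‖b‖ ^ 2 := by gcongr; exact hminf a ha
      _ = -ρ a * (φ a * ‖b‖ ^ 2) := by rw [abs_of_neg hneg]; ring
      _ ≤ -ρ a * (-(ρ a)⁻¹ * leviForm ρ a b) := by
        exact mul_le_mul_of_nonneg_left hL (by linarith)
      _ = leviForm ρ a b := by field_simp [hneg.ne]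
  refine ⟨hinterior, fun a ha b hb0 hb => ?_⟩
  have hacl : a ∈ closure U := frontier_subset_closure ha
  have hfa := hsmooth a hacl
  obtain ⟨β, hβ, hβa, hβ0⟩ := exists_continuousAt_Dprime_eq_zero hfa (hDρ a ha) hb
  have : (nhdsWithin a U).NeBot := mem_closure_iff_nhdsWithin_neBot.1 hacl
  have hle : m * ‖β a‖ ^ 2 ≤ leviForm ρ a (β a) := by
    refine le_of_tendsto_of_tendsto (b := nhdsWithin a U)
      ((continuousAt_const.mul (hβ.norm.pow 2)).mono_left nhdsWithin_le_nhds)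
      ((hfa.continuousAt_leviForm hβ).mono_left nhdsWithin_le_nhds) ?_
    filter_upwards [self_mem_nhdsWithin, nhdsWithin_le_nhds hβ0] with z hz hz0
    exact hinterior z hz _ hz0
  rw [hβa] at hle
  have hbpos : 0 < ‖b‖ := norm_pos_iff.2 hb0
  exact lt_of_lt_of_le (by positivity) hle
end

section
/- Let X be a complex Banach space and suppose there exists I > 0 such that (‖a‖² + I·‖b‖²)^{1/2} ≤ (1/(2π))∫₀^{2π} ‖a + e^{iθ}b‖ dθ for all a, b ∈ X. Set λ₀ := √(I/4 + 1/4) − 1/2 > 0. Then for all a, b ∈ X with ‖a‖ ≤ 2 and ‖b‖ ≤ 2, λ₀·‖b‖² + (‖a‖ − 1) ≤ (1/(2π))∫₀^{2π} (‖a + e^{iθ}b‖ − 1) dθ. In particular, ρ(x) := ‖x‖ − 1 is a uniformly plurisubharmonic defining function for the open unit ball of X on the open ball 2B_X. -/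
open MeasureTheory

/-- If `I = 4 (l ^ 2 + l)` with `l ≥ 0`, then `s + l * t ^ 2 ≤ √(s ^ 2 + I * t ^ 2)` on `[0, 2] ^ 2`. -/
theorem add_mul_sq_le_sqrt {l I s t : ℝ} (hl : 0 ≤ l) (hI : I = 4 * (l ^ 2 + l))
    (hs : s ≤ 2) (ht0 : 0 ≤ t) (ht : t ≤ 2) :
    s + l * t ^ 2 ≤ √(s ^ 2 + I * t ^ 2) := by
  apply Real.le_sqrt_of_sq_le
  have h₁ : 0 ≤ l * t ^ 2 * (2 - s) := mul_nonneg (by positivity) (by linarith)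
  have h₂ : 0 ≤ l ^ 2 * t ^ 2 * (4 - t ^ 2) := mul_nonneg (by positivity) (by nlinarith)
  subst hI
  nlinarith

/-- The circle average of `‖x‖ - 1` is the circle average of the norm minus one. -/
theorem circle_average_norm_sub_one {X : Type*} [NormedAddCommGroup X] [NormedSpace ℂ X]
    (a b : X) :
    (1 / (2 * Real.pi)) *
        ∫ θ in (0:ℝ)..(2 * Real.pi), (‖a + Complex.exp (θ * Complex.I) • b‖ - 1) =
      (1 / (2 * Real.pi)) *
        (∫ θ in (0:ℝ)..(2 * Real.pi), ‖a + Complex.exp (θ * Complex.I) • b‖) - 1 := by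
  have hc : Continuous fun θ : ℝ => ‖a + Complex.exp (θ * Complex.I) • b‖ := by fun_prop
  rw [intervalIntegral.integral_sub (hc.intervalIntegrable _ _) (by simp)]
  rw [intervalIntegral.integral_const, smul_eq_mul, mul_one, sub_zero, mul_sub,
    one_div_mul_cancel Real.two_pi_pos.ne']

/-- If the balanced disc `a + 𝔻 b` lies in the ball of radius `r`, then `‖b‖ < r`. -/
theorem norm_lt_of_forall_norm_add_smul_lt {X : Type*} [NormedAddCommGroup X] [NormedSpace ℂ X]
    {a b : X} {r : ℝ} (h : ∀ z : ℂ, ‖z‖ ≤ 1 → ‖a + z • b‖ < r) : ‖b‖ < r := by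
  have h₁ := h 1 (by simp)
  have h₂ := h (-1) (by simp)
  have h₃ := norm_sub_le (a + (1 : ℂ) • b) (a + (-1 : ℂ) • b)
  have h₄ : a + (1 : ℂ) • b - (a + (-1 : ℂ) • b) = (2 : ℂ) • b := by module
  rw [h₄, norm_smul, Complex.norm_ofNat] at h₃
  linarith

/-- If the complex Banach space `X` is 2-uniformly PL-convex, i.e.
`(‖a‖² + I‖b‖²)^{1/2} ≤ (1/(2π))∫₀^{2π} ‖a + e^{iθ}b‖ dθ` for some `I > 0`, then with
`λ₀ := √(I/4 + 1/4) − 1/2 > 0` the function `ρ(x) = ‖x‖ − 1` satisfies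
`λ₀‖b‖² + ρ(a) ≤ (1/(2π))∫₀^{2π} ρ(a + e^{iθ}b) dθ` for `‖a‖ ≤ 2`, `‖b‖ ≤ 2`; in particular
`ρ` is a uniformly plurisubharmonic defining function of the unit ball on `2B_X`. -/
theorem unit_ball_uniformly_pseudoconvex_of_two_uniformly_PL_convex
    (X : Type*) [NormedAddCommGroup X] [NormedSpace ℂ X] [CompleteSpace X]
    (I : ℝ) (hI : 0 < I)
    (hPL : ∀ a b : X, Real.sqrt (‖a‖ ^ 2 + I * ‖b‖ ^ 2) ≤
      (1 / (2 * Real.pi)) * ∫ θ in (0:ℝ)..(2 * Real.pi), ‖a + Complex.exp (θ * Complex.I) • b‖) :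
    0 < Real.sqrt (I / 4 + 1 / 4) - 1 / 2 ∧
    (∀ a b : X, ‖a‖ ≤ 2 → ‖b‖ ≤ 2 →
      (Real.sqrt (I / 4 + 1 / 4) - 1 / 2) * ‖b‖ ^ 2 + (‖a‖ - 1) ≤
        (1 / (2 * Real.pi)) *
          ∫ θ in (0:ℝ)..(2 * Real.pi), (‖a + Complex.exp (θ * Complex.I) • b‖ - 1)) ∧
    (∀ a b : X, (∀ z : ℂ, ‖z‖ ≤ 1 → ‖a + z • b‖ < 2) →
      (Real.sqrt (I / 4 + 1 / 4) - 1 / 2) * ‖b‖ ^ 2 + (‖a‖ - 1) ≤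
        (1 / (2 * Real.pi)) *
          ∫ θ in (0:ℝ)..(2 * Real.pi), (‖a + Complex.exp (θ * Complex.I) • b‖ - 1)) := by
  have hpos : 0 < Real.sqrt (I / 4 + 1 / 4) - 1 / 2 :=
    sub_pos.2 (Real.lt_sqrt_of_sq_lt (by linarith))
  have hsq : Real.sqrt (I / 4 + 1 / 4) ^ 2 = I / 4 + 1 / 4 := Real.sq_sqrt (by linarith)
  have key : ∀ a b : X, ‖a‖ ≤ 2 → ‖b‖ ≤ 2 →
      (Real.sqrt (I / 4 + 1 / 4) - 1 / 2) * ‖b‖ ^ 2 + (‖a‖ - 1) ≤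
        (1 / (2 * Real.pi)) *
          ∫ θ in (0:ℝ)..(2 * Real.pi), (‖a + Complex.exp (θ * Complex.I) • b‖ - 1) := by
    intro a b ha hb
    rw [circle_average_norm_sub_one]
    have h := add_mul_sq_le_sqrt (I := I) hpos.le (by linarith) ha (norm_nonneg b) hb
    linarith [hPL a b]
  refine ⟨hpos, key, fun a b h => key a b ?_ (norm_lt_of_forall_norm_add_smul_lt h).le⟩
  simpa using (h 0 (by simp)).le
end

section
/- Let I > 0 and set λ₀ := √(I/4 + 1/4) − 1/2. Then for all real numbers s, t with 0 ≤ s ≤ 2 and 0 ≤ t ≤ 2, s + λ₀·t² ≤ (s² + I·t²)^{1/2}. -/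
/-- For `I > 0` and `λ₀ := √(I/4 + 1/4) − 1/2`, one has
`s + λ₀·t² ≤ (s² + I·t²)^{1/2}` for all `s, t ∈ [0, 2]`. -/
theorem add_lambda_sq_le_sqrt (I : ℝ) (hI : 0 < I) (s t : ℝ)
    (hs0 : 0 ≤ s) (hs2 : s ≤ 2) (ht0 : 0 ≤ t) (ht2 : t ≤ 2) :
    s + (Real.sqrt (I / 4 + 1 / 4) - 1 / 2) * t ^ 2 ≤ Real.sqrt (s ^ 2 + I * t ^ 2) := by
  have hsq : Real.sqrt (I / 4 + 1 / 4) ^ 2 = I / 4 + 1 / 4 := Real.sq_sqrt (by positivity)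
  have hl : 0 ≤ Real.sqrt (I / 4 + 1 / 4) - 1 / 2 :=
    sub_nonneg.2 (Real.le_sqrt_of_sq_le (by linarith))
  set l := Real.sqrt (I / 4 + 1 / 4) - 1 / 2 with hl_def
  have hI_eq : I = 4 * l + 4 * l ^ 2 := by rw [hl_def]; linarith
  have ht : t ^ 2 ≤ 4 := by nlinarith
  have hsl : l * s ≤ l * 2 := mul_le_mul_of_nonneg_left hs2 hl
  have htl : l ^ 2 * t ^ 2 ≤ l ^ 2 * 4 := mul_le_mul_of_nonneg_left ht (sq_nonneg l)
  have key : (2 * (l * s) + l ^ 2 * t ^ 2) * t ^ 2 ≤ I * t ^ 2 :=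
    mul_le_mul_of_nonneg_right (by linarith) (sq_nonneg t)
  exact Real.le_sqrt_of_sq_le (by linarith)
end

section
/- Let X be a complex normed space, let q > 0, let r ≥ 2 and let C ≥ 1. Suppose Δ_q^X(ε) ≥ (ε/C)^r for every ε ∈ (0, 3]. Then, with λ := min{1, r/C^r, (2^r − 1)/3^r} ∈ (0,1], for all x, y ∈ X: ((1/(2π))∫₀^{2π} ‖x + e^{iθ}y‖^q dθ)^{1/q} ≥ (‖x‖^r + λ·‖y‖^r)^{1/r}. -/
/-- The modulus `Δ_q^X(ε) = inf{((‖x+y‖^q + ‖x−y‖^q)/2)^{1/q} − 1 : ‖x‖ = 1, ‖y‖ ≥ ε}`. -/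
noncomputable def DeltaModPL (X : Type*) [NormedAddCommGroup X] (q ε : ℝ) : ℝ :=
  sInf {d : ℝ | ∃ x y : X, ‖x‖ = 1 ∧ ε ≤ ‖y‖ ∧
    d = ((‖x + y‖ ^ q + ‖x - y‖ ^ q) / 2) ^ (1 / q) - 1}

open MeasureTheory intervalIntegral

/-- The power mean of two nonnegative reals is homogeneous. -/
lemma powerMean_mul {q : ℝ} (hq : 0 < q) {a s t : ℝ} (ha : 0 ≤ a) (hs : 0 ≤ s) (ht : 0 ≤ t) :
    (((a * s) ^ q + (a * t) ^ q) / 2) ^ (1 / q) = a * ((s ^ q + t ^ q) / 2) ^ (1 / q) := by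
  have h : ((a * s) ^ q + (a * t) ^ q) / 2 = a ^ q * ((s ^ q + t ^ q) / 2) := by
    rw [Real.mul_rpow ha hs, Real.mul_rpow ha ht]; ring
  rw [h, Real.mul_rpow (by positivity) (by positivity), one_div, Real.rpow_rpow_inv ha hq.ne']

lemma rpow_add_mul_rpow_rpow_one_div {r : ℝ} (hr : 0 < r) {a e l : ℝ} (ha : 0 ≤ a) (he : 0 ≤ e)
    (hl : 0 ≤ l) :
    (a ^ r + l * (a * e) ^ r) ^ (1 / r) = a * (1 + l * e ^ r) ^ (1 / r) := by
  have h : a ^ r + l * (a * e) ^ r = a ^ r * (1 + l * e ^ r) := by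
    rw [Real.mul_rpow ha he]; ring
  rw [h, Real.mul_rpow (by positivity) (by positivity), one_div, Real.rpow_rpow_inv ha (ne_of_gt hr)]

/-- A common lower bound of two reals is a lower bound of their power mean. -/
lemma le_powerMean {q : ℝ} (hq : 0 < q) {b s t : ℝ} (hb : 0 ≤ b) (hs : b ≤ s) (ht : b ≤ t) :
    b ≤ ((s ^ q + t ^ q) / 2) ^ (1 / q) := by
  have h1 := Real.rpow_le_rpow hb hs hq.le
  have h2 := Real.rpow_le_rpow hb ht hq.le
  have hbq : 0 ≤ b ^ q := by positivity
  rw [one_div, Real.le_rpow_inv_iff_of_pos hb (by linarith) hq]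
  linarith

lemma one_add_mul_rpow_le_sub_one_rpow {r l e : ℝ} (hr : 0 < r) (he : 3 ≤ e)
    (hl : l ≤ ((2 : ℝ) ^ r - 1) / 3 ^ r) : 1 + l * e ^ r ≤ (e - 1) ^ r := by
  obtain ⟨s, rfl⟩ : ∃ s, e = 3 * s := ⟨e / 3, by ring⟩
  have hs : 1 ≤ s := by linarith
  have h3 : (0 : ℝ) < 3 ^ r := by positivity
  have hs' : 1 ≤ s ^ r := Real.one_le_rpow hs hr.le
  rw [le_div_iff₀ h3] at hl
  calc 1 + l * (3 * s) ^ r = 1 + l * 3 ^ r * s ^ r := by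
        rw [Real.mul_rpow (by norm_num) (by linarith)]; ring
    _ ≤ 1 + (2 ^ r - 1) * s ^ r := by gcongr
    _ ≤ 2 ^ r * s ^ r := by linarith
    _ = (2 * s) ^ r := (Real.mul_rpow (by norm_num) (by linarith)).symm
    _ ≤ (3 * s - 1) ^ r := Real.rpow_le_rpow (by linarith) (by linarith) hr.le

lemma DeltaModPL_le {X : Type*} [NormedAddCommGroup X] (q : ℝ) {ε : ℝ} {x y : X}
    (hx : ‖x‖ = 1) (hy : ε ≤ ‖y‖) :
    DeltaModPL X q ε ≤ ((‖x + y‖ ^ q + ‖x - y‖ ^ q) / 2) ^ (1 / q) - 1 := by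
  refine csInf_le ⟨-1, ?_⟩ ⟨x, y, hx, hy, rfl⟩
  rintro d ⟨u, v, -, -, rfl⟩
  have : 0 ≤ ((‖u + v‖ ^ q + ‖u - v‖ ^ q) / 2) ^ (1 / q) := by positivity
  linarith

section TwoPoint

variable {X : Type*} [NormedAddCommGroup X] {q r C l : ℝ}

lemma one_add_mul_norm_rpow_le_powerMean (hq : 0 < q) (hr : 1 ≤ r) (hC : 0 < C)
    (hΔ : ∀ ε : ℝ, 0 < ε → ε ≤ 3 → (ε / C) ^ r ≤ DeltaModPL X q ε)
    (hl0 : 0 ≤ l) (hlC : l ≤ r / C ^ r) (hl3 : l ≤ ((2 : ℝ) ^ r - 1) / 3 ^ r)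
    {x : X} (hx : ‖x‖ = 1) (y : X) :
    (1 + l * ‖y‖ ^ r) ^ (1 / r) ≤ ((‖x + y‖ ^ q + ‖x - y‖ ^ q) / 2) ^ (1 / q) := by
  have hr0 : 0 < r := by linarith
  rcases (norm_nonneg y).eq_or_lt with h0 | h0
  · have hy : y = 0 := norm_eq_zero.1 h0.symm
    simp [hy, hx, hr0.ne']
  rcases le_total ‖y‖ 3 with h3 | h3
  · have hCr : 0 < C ^ r := by positivity
    have hbern : (1 + l * ‖y‖ ^ r) ^ (1 / r) ≤ 1 + 1 / r * (l * ‖y‖ ^ r) :=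
      rpow_one_add_le_one_add_mul_self (by linarith [show 0 ≤ l * ‖y‖ ^ r by positivity])
        (by positivity) ((div_le_one hr0).2 hr)
    have hlin : 1 / r * (l * ‖y‖ ^ r) ≤ (‖y‖ / C) ^ r := by
      calc 1 / r * (l * ‖y‖ ^ r) ≤ 1 / r * (r / C ^ r * ‖y‖ ^ r) := by gcongr
        _ = (‖y‖ / C) ^ r := by
          rw [Real.div_rpow h0.le hC.le]; field_simp
    linarith [hΔ _ h0 h3, DeltaModPL_le q hx (le_refl ‖y‖)]
  · have hb : (1 + l * ‖y‖ ^ r) ^ (1 / r) ≤ ‖y‖ - 1 := by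
      rw [one_div, Real.rpow_inv_le_iff_of_pos (by positivity) (by linarith) hr0]
      exact one_add_mul_rpow_le_sub_one_rpow hr0 h3 hl3
    refine hb.trans (le_powerMean hq (by linarith) ?_ ?_)
    · have := norm_sub_norm_le y (-x)
      rw [sub_neg_eq_add, norm_neg, hx, add_comm] at this
      exact this
    · have := norm_sub_norm_le y x
      rwa [hx, norm_sub_rev] at this

/-- The two-point form of uniform PL-convexity. -/
lemma norm_rpow_add_mul_norm_rpow_le_powerMean [NormedSpace ℝ X] (hq : 0 < q) (hr : 1 ≤ r)
    (hC : 0 < C) (hΔ : ∀ ε : ℝ, 0 < ε → ε ≤ 3 → (ε / C) ^ r ≤ DeltaModPL X q ε)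
    (hl0 : 0 ≤ l) (hl1 : l ≤ 1) (hlC : l ≤ r / C ^ r) (hl3 : l ≤ ((2 : ℝ) ^ r - 1) / 3 ^ r)
    (x y : X) :
    (‖x‖ ^ r + l * ‖y‖ ^ r) ^ (1 / r) ≤ ((‖x + y‖ ^ q + ‖x - y‖ ^ q) / 2) ^ (1 / q) := by
  have hr0 : 0 < r := by linarith
  rcases eq_or_ne x 0 with rfl | hx
  · have hle : (‖(0 : X)‖ ^ r + l * ‖y‖ ^ r) ^ (1 / r) ≤ ‖y‖ := by
      rw [one_div, Real.rpow_inv_le_iff_of_pos (by positivity) (by positivity) hr0, norm_zero,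
        Real.zero_rpow hr0.ne', zero_add]
      exact mul_le_of_le_one_left (by positivity) hl1
    exact hle.trans (le_powerMean hq (norm_nonneg y) (by simp) (by simp))
  · have ha : 0 < ‖x‖ := norm_pos_iff.2 hx
    have hscale : ∀ z : X, ‖x‖ * ‖‖x‖⁻¹ • z‖ = ‖z‖ := fun z ↦ by
      rw [norm_smul, norm_inv, norm_norm, mul_inv_cancel_left₀ ha.ne']
    have hunit : ‖‖x‖⁻¹ • x‖ = 1 := by
      rw [norm_smul, norm_inv, norm_norm, inv_mul_cancel₀ ha.ne']
    have key := one_add_mul_norm_rpow_le_powerMean hq hr hC hΔ hl0 hlC hl3 hunit (‖x‖⁻¹ • y)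
    rw [← smul_add, ← smul_sub] at key
    have := mul_le_mul_of_nonneg_left key ha.le
    rwa [← rpow_add_mul_rpow_rpow_one_div hr0 ha.le (norm_nonneg _) hl0,
      ← powerMean_mul hq ha.le (norm_nonneg _) (norm_nonneg _), hscale, hscale, hscale] at this

end TwoPoint

/-- A lower bound for the two-point power means of `x` and `e^{iθ}y` is a lower bound for the
power mean over the circle. -/
lemma le_circle_powerMean_of_forall_le {X : Type*} [NormedAddCommGroup X] [NormedSpace ℂ X]
    {q A : ℝ} (hq : 0 < q) (hA : 0 ≤ A) (x y : X)
    (h : ∀ θ : ℝ, A ≤ ((‖x + Complex.exp (θ * Complex.I) • y‖ ^ q +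
      ‖x - Complex.exp (θ * Complex.I) • y‖ ^ q) / 2) ^ (1 / q)) :
    A ≤ ((1 / (2 * Real.pi)) *
      ∫ θ in (0:ℝ)..(2 * Real.pi), ‖x + Complex.exp (θ * Complex.I) • y‖ ^ q) ^ (1 / q) := by
  set f : ℝ → ℝ := fun θ ↦ ‖x + Complex.exp (θ * Complex.I) • y‖ ^ q with hf
  have hcont : Continuous f :=
    Continuous.rpow_const (by fun_prop) fun _ ↦ Or.inr hq.le
  have hshift : ∀ θ : ℝ, f (θ + Real.pi) = ‖x - Complex.exp (θ * Complex.I) • y‖ ^ q := fun θ ↦ by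
    simp only [hf, Complex.ofReal_add, add_mul, Complex.exp_add, Complex.exp_pi_mul_I, mul_neg_one,
      neg_smul, sub_eq_add_neg]
  have hpt : ∀ θ : ℝ, 2 * A ^ q ≤ f θ + f (θ + Real.pi) := fun θ ↦ by
    have := h θ
    rw [one_div, Real.le_rpow_inv_iff_of_pos hA (by positivity) hq] at this
    rw [hshift]
    linarith
  have hsplit : ∫ θ in (0:ℝ)..(2 * Real.pi), f θ =
      ∫ θ in (0:ℝ)..Real.pi, (f θ + f (θ + Real.pi)) := by
    rw [integral_add (hcont.intervalIntegrable _ _)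
        ((by fun_prop : Continuous fun θ ↦ f (θ + Real.pi)).intervalIntegrable _ _),
      integral_comp_add_right, zero_add, ← two_mul,
      integral_add_adjacent_intervals (hcont.intervalIntegrable _ _)
        (hcont.intervalIntegrable _ _)]
  have hint : Real.pi * (2 * A ^ q) ≤ ∫ θ in (0:ℝ)..(2 * Real.pi), f θ := by
    rw [hsplit]
    have := integral_mono_on (μ := volume) Real.pi_pos.le
      (intervalIntegrable_const (c := 2 * A ^ q))
      ((by fun_prop : Continuous fun θ ↦ f θ + f (θ + Real.pi)).intervalIntegrable _ _)
      fun θ _ ↦ hpt θ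
    simpa [mul_left_comm] using this
  have hmean : A ^ q ≤ 1 / (2 * Real.pi) * ∫ θ in (0:ℝ)..(2 * Real.pi), f θ := by
    rw [one_div, ← div_eq_inv_mul, le_div_iff₀ Real.two_pi_pos]
    linarith
  rwa [one_div q, Real.le_rpow_inv_iff_of_pos hA (le_trans (by positivity) hmean) hq]

/-- If `Δ_q^X(ε) ≥ (ε/C)^r` for all `ε ∈ (0,3]`, then with
`λ := min{1, r/C^r, (2^r − 1)/3^r}` one has `λ ∈ (0,1]` and
`((1/(2π))∫₀^{2π}‖x + e^{iθ}y‖^q dθ)^{1/q} ≥ (‖x‖^r + λ‖y‖^r)^{1/r}` for all `x, y`;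
that is, `X` is `r`-uniformly PL-convex. -/
theorem r_uniformly_PL_convex_of_DeltaModPL_bound
    (X : Type*) [NormedAddCommGroup X] [NormedSpace ℂ X]
    (q r C : ℝ) (hq : 0 < q) (hr : 2 ≤ r) (hC : 1 ≤ C)
    (hΔ : ∀ ε : ℝ, 0 < ε → ε ≤ 3 → (ε / C) ^ r ≤ DeltaModPL X q ε) :
    (0 < min (min 1 (r / C ^ r)) (((2:ℝ) ^ r - 1) / 3 ^ r) ∧
      min (min 1 (r / C ^ r)) (((2:ℝ) ^ r - 1) / 3 ^ r) ≤ 1) ∧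
    ∀ x y : X,
      (‖x‖ ^ r + min (min 1 (r / C ^ r)) (((2:ℝ) ^ r - 1) / 3 ^ r) * ‖y‖ ^ r) ^ (1 / r) ≤
        ((1 / (2 * Real.pi)) *
          ∫ θ in (0:ℝ)..(2 * Real.pi), ‖x + Complex.exp (θ * Complex.I) • y‖ ^ q) ^ (1 / q) := by
  have hr0 : 0 < r := by linarith
  have hC0 : 0 < C := by linarith
  have h2 : (1 : ℝ) < 2 ^ r := Real.one_lt_rpow (by norm_num) hr0
  set l := min (min 1 (r / C ^ r)) (((2:ℝ) ^ r - 1) / 3 ^ r)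
  have hl0 : 0 < l :=
    lt_min (lt_min one_pos (by positivity)) (div_pos (by linarith) (by positivity))
  have hl1 : l ≤ 1 := (min_le_left _ _).trans (min_le_left _ _)
  refine ⟨⟨hl0, hl1⟩, fun x y ↦ ?_⟩
  refine le_circle_powerMean_of_forall_le hq (by positivity) x y fun θ ↦ ?_
  let : NormedSpace ℝ X := NormedSpace.restrictScalars ℝ ℂ X
  have := norm_rpow_add_mul_norm_rpow_le_powerMean hq (by linarith) hC0 hΔ hl0.le hl1
    ((min_le_left _ _).trans (min_le_right _ _)) (min_le_right _ _) x
    (Complex.exp (θ * Complex.I) • y)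
  rwa [norm_smul, Complex.norm_exp_ofReal_mul_I, one_mul] at this
end

section
/- Let X be a complex normed space of dimension at least 2, let r ≥ 2 and let C ≥ 1, and suppose X is r-uniformly convex, i.e. δ_X(ε) ≥ (ε/C)^r for every ε ∈ (0, 2]. Then X is r-uniformly PL-convex: for every q > 1 there exists λ ∈ (0, 1] such that ((1/(2π))∫₀^{2π} ‖x + e^{iθ}y‖^q dθ)^{1/q} ≥ (‖x‖^r + λ·‖y‖^r)^{1/r} for all x, y ∈ X. -/
/-- The modulus of convexity `δ_X(ε) = inf{1 − ‖x+y‖/2 : ‖x‖ ≤ 1, ‖y‖ ≤ 1, ‖x−y‖ ≥ ε}`. -/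
noncomputable def convexityModulus (X : Type*) [NormedAddCommGroup X] (ε : ℝ) : ℝ :=
  sInf {d : ℝ | ∃ x y : X, ‖x‖ ≤ 1 ∧ ‖y‖ ≤ 1 ∧ ε ≤ ‖x - y‖ ∧ d = 1 - ‖x + y‖ / 2}

open Real intervalIntegral

/-- A rational lower bound for `(1 + t) ^ (1 + p)`, from Bernoulli's inequality. -/
theorem sq_div_le_one_add_rpow {p t : ℝ} (hp : 0 < p) (hp1 : p ≤ 1) (ht : -1 ≤ t) (ht1 : t ≤ 1) :
    (1 + t) ^ 2 / (1 + (1 - p) * t) ≤ (1 + t) ^ (1 + p) := by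
  rcases eq_or_lt_of_le ht with rfl | ht
  · norm_num
    positivity
  have h0 : 0 < 1 + t := by linarith
  have hk : 0 < 1 + (1 - p) * t := by nlinarith
  have hB : (1 + -t / (1 + t)) ^ p ≤ 1 + p * (-t / (1 + t)) := by
    refine rpow_one_add_le_one_add_mul_self ?_ hp.le hp1
    rw [le_div_iff₀ h0]
    linarith
  have e1 : 1 + -t / (1 + t) = (1 + t)⁻¹ := by field_simp; ring
  have e2 : 1 + p * (-t / (1 + t)) = (1 + (1 - p) * t) / (1 + t) := by field_simp; ring
  rw [e1, e2, inv_rpow h0.le] at hB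
  have hpos : 0 < (1 + t) ^ p := rpow_pos_of_pos h0 p
  rw [inv_le_comm₀ hpos (by positivity), inv_div] at hB
  rw [rpow_add h0, rpow_one]
  calc (1 + t) ^ 2 / (1 + (1 - p) * t) = (1 + t) * ((1 + t) / (1 + (1 - p) * t)) := by ring
    _ ≤ _ := by gcongr

theorem one_add_sq_le_rpow_mean {p t : ℝ} (hp : 0 < p) (hp1 : p ≤ 1) (ht : 0 ≤ t) (ht1 : t ≤ 1) :
    1 + p ^ 2 * t ^ 2 ≤ ((1 + t) ^ (1 + p) + (1 - t) ^ (1 + p)) / 2 := by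
  have h1 := sq_div_le_one_add_rpow hp hp1 (by linarith) ht1
  have h2 := sq_div_le_one_add_rpow hp hp1 (t := -t) (by linarith) (by linarith)
  have hk1 : 0 < 1 + (1 - p) * t := by nlinarith
  have hk2 : 0 < 1 + (1 - p) * (-t) := by nlinarith
  have h3 : 1 + p ^ 2 * t ^ 2 ≤
      ((1 + t) ^ 2 / (1 + (1 - p) * t) + (1 + -t) ^ 2 / (1 + (1 - p) * (-t))) / 2 := by
    rw [div_add_div _ _ hk1.ne' hk2.ne', div_div, le_div_iff₀ (by positivity)]
    have : 0 ≤ p ^ 2 * t ^ 2 * ((1 - p) ^ 2 * t ^ 2) := by positivity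
    linarith
  rw [← sub_eq_add_neg] at h2 h3
  linarith

/-- Power means are monotone in the exponent. -/
theorem rpow_mean_mono {a b p q r : ℝ} (ha : 0 ≤ a) (hb : 0 ≤ b) (hp : 0 < p) (hpq : p ≤ q)
    (hr : 0 ≤ r) : ((a ^ p + b ^ p) / 2) ^ (r / p) ≤ ((a ^ q + b ^ q) / 2) ^ (r / q) := by
  have hq : 0 < q := hp.trans_le hpq
  have h := (convexOn_rpow ((one_le_div hp).2 hpq)).2 (rpow_nonneg ha p) (rpow_nonneg hb p)
    (by norm_num : (0 : ℝ) ≤ 1 / 2) (by norm_num : (0 : ℝ) ≤ 1 / 2) (by norm_num)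
  simp only [smul_eq_mul] at h
  rw [← rpow_mul ha, ← rpow_mul hb, mul_div_cancel₀ _ hp.ne'] at h
  have h' : ((a ^ p + b ^ p) / 2) ^ (q / p) ≤ (a ^ q + b ^ q) / 2 := by
    rw [show (a ^ p + b ^ p) / 2 = 1 / 2 * a ^ p + 1 / 2 * b ^ p by ring]
    linarith
  calc ((a ^ p + b ^ p) / 2) ^ (r / p) = (((a ^ p + b ^ p) / 2) ^ (q / p)) ^ (r / q) := by
        rw [← rpow_mul (by positivity)]
        congr 1
        field_simp
    _ ≤ _ := by gcongr

/-- The power mean of exponent `q > 1` exceeds the arithmetic mean quantitatively. -/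
theorem exists_add_rpow_le_rpow_mean {q r : ℝ} (hq : 1 < q) (hr : 2 ≤ r) :
    ∃ c : ℝ, 0 < c ∧ ∀ a b : ℝ, 0 ≤ b → b ≤ a →
      ((a + b) / 2) ^ r + c * ((a - b) / 2) ^ r ≤ ((a ^ q + b ^ q) / 2) ^ (r / q) := by
  obtain ⟨p, hp, hp1, hpq⟩ : ∃ p : ℝ, 0 < p ∧ p ≤ 1 ∧ 1 + p ≤ q :=
    ⟨min (q - 1) 1, by simp [hq], min_le_right _ _, by linarith [min_le_left (q - 1) 1]⟩
  refine ⟨p ^ 2, by positivity, fun a b hb hab => ?_⟩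
  refine le_trans ?_ (rpow_mean_mono (hb.trans hab) hb (by linarith) hpq (by linarith))
  rcases eq_or_lt_of_le (hb.trans hab) with rfl | ha
  · obtain rfl : b = 0 := le_antisymm hab hb
    simp [zero_rpow (by linarith : r ≠ 0), zero_rpow (by linarith : 1 + p ≠ 0),
      zero_rpow (by positivity : r / (1 + p) ≠ 0)]
  obtain ⟨s, hs⟩ : ∃ s, s = (a + b) / 2 := ⟨_, rfl⟩
  have hs0 : 0 < s := by linarith
  obtain ⟨t, ht⟩ : ∃ t, t = (a - b) / 2 / s := ⟨_, rfl⟩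
  have hst : s * t = (a - b) / 2 := by rw [ht]; field_simp
  have ht0 : 0 ≤ t := by rw [ht]; exact div_nonneg (by linarith) hs0.le
  have ht1 : t ≤ 1 := by rw [ht, div_le_one hs0]; linarith
  have ea : a = s * (1 + t) := by linarith
  have eb : b = s * (1 - t) := by linarith
  have hm := one_add_sq_le_rpow_mean hp hp1 ht0 ht1
  have h1t : 0 ≤ 1 - t := by linarith
  have htr : t ^ r ≤ t ^ 2 := by
    rcases eq_or_lt_of_le ht0 with rfl | h
    · rw [zero_rpow (by linarith)]; norm_num
    · rw [← rpow_two]; exact rpow_le_rpow_of_exponent_ge h ht1 hr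
  rw [← hs, ← hst, ea, eb, mul_rpow hs0.le ht0, mul_rpow hs0.le (by positivity),
    mul_rpow hs0.le h1t, ← mul_add, mul_div_assoc, mul_rpow (by positivity) (by positivity),
    ← rpow_mul hs0.le, mul_div_cancel₀ _ (by linarith : 1 + p ≠ 0)]
  calc s ^ r + p ^ 2 * (s ^ r * t ^ r) = s ^ r * (1 + p ^ 2 * t ^ r) := by ring
    _ ≤ s ^ r * (1 + p ^ 2 * t ^ 2) := by gcongr
    _ ≤ s ^ r * (1 + p ^ 2 * t ^ 2) ^ (r / (1 + p)) := by
        gcongr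
        refine self_le_rpow_of_one_le (by nlinarith [sq_nonneg (p * t)]) ?_
        rw [one_le_div (by linarith)]
        linarith
    _ ≤ _ := by gcongr

section UniformConvexity

variable {X : Type*} [NormedAddCommGroup X]

theorem norm_add_le_of_le_convexityModulus {r C : ℝ} (hr : 0 < r)
    (hconv : ∀ ε : ℝ, 0 < ε → ε ≤ 2 → (ε / C) ^ r ≤ convexityModulus X ε)
    {u v : X} (hu : ‖u‖ ≤ 1) (hv : ‖v‖ ≤ 1) :
    ‖u + v‖ ≤ 2 * (1 - (‖u - v‖ / C) ^ r) := by
  rcases eq_or_lt_of_le (norm_nonneg (u - v)) with h | h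
  · rw [← h, zero_div, zero_rpow hr.ne']
    linarith [norm_add_le u v]
  · have h1 := hconv ‖u - v‖ h (by linarith [norm_sub_le u v])
    have h2 : convexityModulus X ‖u - v‖ ≤ 1 - ‖u + v‖ / 2 := by
      refine csInf_le ⟨0, ?_⟩ ⟨u, v, hu, hv, le_rfl, rfl⟩
      rintro d ⟨x, y, hx, hy, -, rfl⟩
      linarith [norm_add_le x y]
    linarith

variable [NormedSpace ℝ X]

/-- The midpoint of two vectors of comparable norms in an `r`-uniformly convex space. -/
theorem norm_rpow_add_le_of_sub_le {r C : ℝ} (hr : 2 ≤ r) (hC : 1 ≤ C)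
    (hconv : ∀ ε : ℝ, 0 < ε → ε ≤ 2 → (ε / C) ^ r ≤ convexityModulus X ε)
    {x z : X} (hle : ‖x - z‖ ≤ ‖x + z‖) (hd : (‖x + z‖ - ‖x - z‖) / 2 < ‖z‖ / 4) :
    ‖x‖ ^ r + (1 / (2 * C)) ^ r * ‖z‖ ^ r ≤ ((‖x + z‖ + ‖x - z‖) / 2) ^ r := by
  obtain ⟨a, ha⟩ : ∃ a, a = ‖x + z‖ := ⟨_, rfl⟩
  obtain ⟨b, hb⟩ : ∃ b, b = ‖x - z‖ := ⟨_, rfl⟩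
  have hx2 : ‖(2 : ℝ) • x‖ = 2 * ‖x‖ := by rw [norm_smul]; norm_num
  have hz2 : ‖(2 : ℝ) • z‖ = 2 * ‖z‖ := by rw [norm_smul]; norm_num
  have hxab : 2 * ‖x‖ ≤ a + b := by
    rw [← hx2, ha, hb]
    have e : (2 : ℝ) • x = x + z + (x - z) := by module
    exact e ▸ norm_add_le (x + z) (x - z)
  have hzab : 2 * ‖z‖ ≤ a + b := by
    rw [← hz2, ha, hb]
    have e : (2 : ℝ) • z = x + z - (x - z) := by module
    exact e ▸ norm_sub_le (x + z) (x - z)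
  rw [← ha, ← hb] at hle hd ⊢
  have hz0 : 0 < ‖z‖ := by linarith
  have ha0 : 0 < a := by linarith
  have hb2 : a / 2 ≤ b := by linarith
  have hb0 : 0 < b := by linarith
  obtain ⟨u, hu⟩ : ∃ u, u = a⁻¹ • (x + z) := ⟨_, rfl⟩
  obtain ⟨v, hv⟩ : ∃ v, v = b⁻¹ • (x - z) := ⟨_, rfl⟩
  have hu' : a • u = x + z := by rw [hu, smul_inv_smul₀ ha0.ne']
  have hv' : b • v = x - z := by rw [hv, smul_inv_smul₀ hb0.ne']
  have hu1 : ‖u‖ = 1 := by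
    rw [hu, norm_smul, ← ha, norm_inv, norm_of_nonneg ha0.le, inv_mul_cancel₀ ha0.ne']
  have hv1 : ‖v‖ = 1 := by
    rw [hv, norm_smul, ← hb, norm_inv, norm_of_nonneg hb0.le, inv_mul_cancel₀ hb0.ne']
  have hmid := norm_add_le_of_le_convexityModulus (by linarith) hconv hu1.le hv1.le
  obtain ⟨w, hw⟩ : ∃ w, w = ‖u - v‖ := ⟨_, rfl⟩
  rw [← hw] at hmid
  have hw0 : 0 ≤ w := hw ▸ norm_nonneg _
  have hx : ‖x‖ ≤ (a + b) / 2 - b * (w / C) ^ r := by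
    have e : (2 : ℝ) • x = (a - b) • u + b • (u + v) := by
      rw [sub_smul, smul_add, hu', hv']; module
    have h := norm_add_le ((a - b) • u) (b • (u + v))
    rw [← e, hx2, norm_smul, norm_smul, hu1, norm_of_nonneg hb0.le,
      norm_of_nonneg (sub_nonneg.2 hle)] at h
    nlinarith [mul_le_mul_of_nonneg_left hmid hb0.le]
  have hzw : ‖z‖ ≤ a * w := by
    have e : (2 : ℝ) • z = a • (u - v) + (a - b) • v := by
      rw [sub_smul, smul_sub, hu', hv']; module
    have h := norm_add_le (a • (u - v)) ((a - b) • v)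
    rw [← e, hz2, norm_smul, norm_smul, hv1, norm_of_nonneg ha0.le,
      norm_of_nonneg (sub_nonneg.2 hle), ← hw] at h
    linarith
  obtain ⟨s, hs⟩ : ∃ s, s = (a + b) / 2 := ⟨_, rfl⟩
  rw [← hs] at hx ⊢
  have hs0 : 0 < s := by linarith
  have split : ∀ y : ℝ, 0 ≤ y → y ^ r = y ^ (r - 1) * y := fun y hy => by
    rw [← rpow_add_one' hy (by linarith), sub_add_cancel]
  have hxs : ‖x‖ ^ r ≤ s ^ (r - 1) * ‖x‖ := by
    rw [split _ (norm_nonneg x)]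
    have : ‖x‖ ≤ s := by linarith
    gcongr
    linarith
  have hzs : (1 / (2 * C)) ^ r * ‖z‖ ^ r ≤ s ^ (r - 1) * (b * (w / C) ^ r) := by
    calc (1 / (2 * C)) ^ r * ‖z‖ ^ r ≤ (1 / (2 * C)) ^ r * (a * w) ^ r := by gcongr
      _ = (a / 2) ^ r * (w / C) ^ r := by
          rw [← mul_rpow (by positivity) (by positivity),
            ← mul_rpow (by positivity) (by positivity)]
          congr 1
          field_simp
      _ = (a / 2) ^ (r - 1) * (a / 2) * (w / C) ^ r := by rw [split _ (by positivity)]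
      _ ≤ s ^ (r - 1) * b * (w / C) ^ r := by
          gcongr
          · linarith
          · linarith
      _ = _ := by ring
  have hfin := mul_le_mul_of_nonneg_left hx (rpow_nonneg hs0.le (r - 1))
  rw [mul_sub, ← split s hs0.le] at hfin
  linarith

theorem exists_two_point_inequality {r C q : ℝ} (hr : 2 ≤ r) (hC : 1 ≤ C) (hq : 1 < q)
    (hconv : ∀ ε : ℝ, 0 < ε → ε ≤ 2 → (ε / C) ^ r ≤ convexityModulus X ε) :
    ∃ lam : ℝ, 0 < lam ∧ lam ≤ 1 ∧ ∀ x z : X,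
      ‖x‖ ^ r + lam * ‖z‖ ^ r ≤ ((‖x + z‖ ^ q + ‖x - z‖ ^ q) / 2) ^ (r / q) := by
  obtain ⟨c, hc, hmean⟩ := exists_add_rpow_le_rpow_mean hq hr
  refine ⟨min ((1 / (2 * C)) ^ r) (c * (1 / 4) ^ r), by positivity, ?_, ?_⟩
  · refine (min_le_left _ _).trans (rpow_le_one (by positivity) ?_ (by linarith))
    rw [div_le_one (by positivity)]
    linarith
  intro x z
  wlog hle : ‖x - z‖ ≤ ‖x + z‖ generalizing z
  · have h := this (-z) (by rw [sub_neg_eq_add, ← sub_eq_add_neg]; exact (not_le.1 hle).le)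
    rwa [norm_neg, sub_neg_eq_add, ← sub_eq_add_neg, add_comm (‖x - z‖ ^ q)] at h
  have hm := hmean _ _ (norm_nonneg (x - z)) hle
  have hd0 : 0 ≤ (‖x + z‖ - ‖x - z‖) / 2 := by linarith
  rcases lt_or_ge ((‖x + z‖ - ‖x - z‖) / 2) (‖z‖ / 4) with hd | hd
  · have h := norm_rpow_add_le_of_sub_le hr hC hconv hle hd
    have h1 := mul_le_mul_of_nonneg_right
      (min_le_left ((1 / (2 * C)) ^ r) (c * (1 / 4) ^ r)) (rpow_nonneg (norm_nonneg z) r)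
    have h2 : 0 ≤ c * ((‖x + z‖ - ‖x - z‖) / 2) ^ r := by positivity
    linarith
  · have hx : ‖x‖ ≤ (‖x + z‖ + ‖x - z‖) / 2 := by
      have h := norm_add_le (x + z) (x - z)
      rw [show x + z + (x - z) = (2 : ℝ) • x by module, norm_smul, norm_ofNat] at h
      linarith
    refine le_trans ?_ hm
    refine add_le_add (rpow_le_rpow (norm_nonneg x) hx (by linarith)) ?_
    calc _ ≤ c * (1 / 4) ^ r * ‖z‖ ^ r := by gcongr; exact min_le_right _ _
      _ = c * (‖z‖ / 4) ^ r := by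
          rw [mul_assoc, ← mul_rpow (by norm_num) (norm_nonneg z)]
          congr 2
          ring
      _ ≤ _ := by gcongr

end UniformConvexity

/-- Averaging over the circle is invariant under `y ↦ -y`. -/
theorem integral_norm_sub_exp_smul {X : Type*} [NormedAddCommGroup X] [NormedSpace ℂ X]
    (x y : X) (q : ℝ) :
    ∫ θ in (0 : ℝ)..(2 * π), ‖x - Complex.exp (θ * Complex.I) • y‖ ^ q =
      ∫ θ in (0 : ℝ)..(2 * π), ‖x + Complex.exp (θ * Complex.I) • y‖ ^ q := by
  let f : ℝ → ℝ := fun θ => ‖x + Complex.exp (θ * Complex.I) • y‖ ^ q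
  have hper : Function.Periodic f (2 * π) := fun θ => by
    simp only [f]
    push_cast
    rw [add_mul, Complex.exp_periodic]
  have hshift : ∀ θ : ℝ, ‖x - Complex.exp (θ * Complex.I) • y‖ ^ q = f (θ + π) := fun θ => by
    simp only [f]
    push_cast
    rw [add_mul, Complex.exp_add, Complex.exp_pi_mul_I, mul_neg_one, neg_smul, ← sub_eq_add_neg]
  simp_rw [hshift]
  rw [integral_comp_add_right, zero_add, add_comm (2 * π) π, hper.intervalIntegral_add_eq π 0,
    zero_add]

/-- An `r`-uniformly convex complex normed space of dimension at least `2` is `r`-uniformly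
PL-convex: if `δ_X(ε) ≥ (ε/C)^r` for all `ε ∈ (0,2]`, then for every `q > 1` there is
`λ ∈ (0,1]` with `((1/(2π))∫₀^{2π}‖x + e^{iθ}y‖^q dθ)^{1/q} ≥ (‖x‖^r + λ‖y‖^r)^{1/r}`
for all `x, y ∈ X`. -/
theorem r_uniformly_convex_implies_r_uniformly_PL_convex
    (X : Type*) [NormedAddCommGroup X] [NormedSpace ℂ X]
    (hdim : 2 ≤ Module.rank ℂ X)
    (r C : ℝ) (hr : 2 ≤ r) (hC : 1 ≤ C)
    (hconv : ∀ ε : ℝ, 0 < ε → ε ≤ 2 → (ε / C) ^ r ≤ convexityModulus X ε) :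
    ∀ q : ℝ, 1 < q → ∃ lam : ℝ, 0 < lam ∧ lam ≤ 1 ∧
      ∀ x y : X,
        (‖x‖ ^ r + lam * ‖y‖ ^ r) ^ (1 / r) ≤
          ((1 / (2 * Real.pi)) *
            ∫ θ in (0:ℝ)..(2 * Real.pi), ‖x + Complex.exp (θ * Complex.I) • y‖ ^ q) ^ (1 / q) := by
  intro q hq
  let : NormedSpace ℝ X := NormedSpace.restrictScalars ℝ ℂ X
  obtain ⟨lam, hlam, hlam1, htwo⟩ := exists_two_point_inequality (X := X) hr hC hq hconv
  refine ⟨lam, hlam, hlam1, fun x y => ?_⟩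
  have hq0 : 0 < q := by linarith
  have hr0 : 0 < r := by linarith
  have hA : 0 ≤ ‖x‖ ^ r + lam * ‖y‖ ^ r := by positivity
  have hpt : ∀ θ : ℝ, (‖x‖ ^ r + lam * ‖y‖ ^ r) ^ (q / r) ≤
      (‖x + Complex.exp (θ * Complex.I) • y‖ ^ q +
        ‖x - Complex.exp (θ * Complex.I) • y‖ ^ q) / 2 := fun θ => by
    have h := htwo x (Complex.exp (θ * Complex.I) • y)
    rw [norm_smul, Complex.norm_exp_ofReal_mul_I, one_mul] at h
    refine (rpow_le_rpow hA h (by positivity)).trans_eq ?_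
    rw [← rpow_mul (by positivity), div_mul_div_cancel₀ hq0.ne', div_self hr0.ne', rpow_one]
  have hcont₁ : Continuous fun θ : ℝ => ‖x + Complex.exp (θ * Complex.I) • y‖ ^ q :=
    Continuous.rpow_const (by fun_prop) fun _ => Or.inr hq0.le
  have hcont₂ : Continuous fun θ : ℝ => ‖x - Complex.exp (θ * Complex.I) • y‖ ^ q :=
    Continuous.rpow_const (by fun_prop) fun _ => Or.inr hq0.le
  have hint := integral_mono (μ := MeasureTheory.volume) two_pi_pos.le
    (continuous_const.intervalIntegrable _ _)
    (((hcont₁.add hcont₂).div_const 2).intervalIntegrable _ _) hpt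
  simp only [Pi.add_apply] at hint
  rw [integral_const, integral_div,
    integral_add (hcont₁.intervalIntegrable _ _) (hcont₂.intervalIntegrable _ _),
    integral_norm_sub_exp_smul, add_self_div_two, sub_zero, smul_eq_mul] at hint
  calc (‖x‖ ^ r + lam * ‖y‖ ^ r) ^ (1 / r)
      = ((‖x‖ ^ r + lam * ‖y‖ ^ r) ^ (q / r)) ^ (1 / q) := by
        rw [← rpow_mul hA]
        congr 1
        field_simp
    _ ≤ _ := by
        gcongr
        rwa [one_div_mul_eq_div, le_div_iff₀' two_pi_pos]
end

section
/- Let r ≥ 1, λ ∈ (0, 1] and ε ∈ (0, 3] be real numbers. Then (1 + λ·ε^r)^{1/r} − 1 ≥ (4^{1−r}·λ/r)·ε^r. -/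
/-- The tangent line bound for `x ↦ x ^ r` at `y`, evaluated at `1`. -/
theorem rpow_sub_one_le_mul_rpow_sub_one {r y : ℝ} (hr : 1 ≤ r) (hy : 0 < y) :
    y ^ r - 1 ≤ r * y ^ (r - 1) * (y - 1) := by
  have h := one_add_mul_self_le_rpow_one_add (s := y⁻¹ - 1)
    (by linarith [inv_pos.mpr hy]) hr
  rw [add_sub_cancel, Real.inv_rpow hy.le] at h
  have hpos : 0 < y ^ r := Real.rpow_pos_of_pos hy r
  have hmul := mul_le_mul_of_nonneg_left h hpos.le
  rw [mul_inv_cancel₀ hpos.ne'] at hmul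
  have hsub : y ^ (r - 1) = y ^ r * y⁻¹ := by
    rw [Real.rpow_sub_one hy.ne', div_eq_mul_inv]
  have heq : r * y ^ (r - 1) * (y - 1) = r * y ^ r - r * y ^ r * y⁻¹ := by
    rw [hsub]
    field_simp
  rw [heq]
  linarith

/-- For real `r ≥ 1`, `λ ∈ (0,1]` and `ε ∈ (0,3]`,
`(1 + λ·ε^r)^{1/r} − 1 ≥ 4^{1−r}·λ/r·ε^r`. -/
theorem rpow_one_div_sub_one_ge (r lam ε : ℝ) (hr : 1 ≤ r)
    (hlam0 : 0 < lam) (hlam1 : lam ≤ 1) (hε0 : 0 < ε) (hε3 : ε ≤ 3) :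
    (4:ℝ) ^ (1 - r) * lam / r * ε ^ r ≤ (1 + lam * ε ^ r) ^ (1 / r) - 1 := by
  have hr0 : 0 < r := by linarith
  have hεr : 0 < ε ^ r := Real.rpow_pos_of_pos hε0 r
  have ht : 0 < lam * ε ^ r := mul_pos hlam0 hεr
  have hbase : 1 + lam * ε ^ r ≤ 4 ^ r := by
    have hadd := Real.add_rpow_le_rpow_add zero_le_one hε0.le hr
    rw [Real.one_rpow] at hadd
    have hmono : (1 + ε) ^ r ≤ 4 ^ r :=
      Real.rpow_le_rpow (by linarith) (by linarith) hr0.le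
    nlinarith
  set y := (1 + lam * ε ^ r) ^ (1 / r) with hy
  have hyr : y ^ r = 1 + lam * ε ^ r := by
    rw [hy, one_div, Real.rpow_inv_rpow (by linarith) hr0.ne']
  have hy1 : 1 ≤ y := Real.one_le_rpow (by linarith) (by positivity)
  have hy4 : y ≤ 4 := by
    rwa [← Real.rpow_le_rpow_iff (by linarith) (by norm_num) hr0, hyr]
  have htangent := rpow_sub_one_le_mul_rpow_sub_one hr (by linarith : 0 < y)
  have hpow : y ^ (r - 1) ≤ 4 ^ (r - 1) :=
    Real.rpow_le_rpow (by linarith) hy4 (by linarith)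
  have hbound : lam * ε ^ r ≤ r * 4 ^ (r - 1) * (y - 1) := by
    calc lam * ε ^ r = y ^ r - 1 := by rw [hyr]; ring
      _ ≤ r * y ^ (r - 1) * (y - 1) := htangent
      _ ≤ r * 4 ^ (r - 1) * (y - 1) := by
        have : 0 ≤ y - 1 := by linarith
        gcongr
  have h4 : (0:ℝ) < 4 ^ (r - 1) := by positivity
  calc (4:ℝ) ^ (1 - r) * lam / r * ε ^ r = lam * ε ^ r / (r * 4 ^ (r - 1)) := by
        rw [← neg_sub r 1, Real.rpow_neg (by norm_num)]
        field_simp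
    _ ≤ y - 1 := by
        rw [div_le_iff₀ (by positivity)]
        linarith
end

section
/- Let X be a complex normed space containing at least one vector of norm 1, let p > 0, r ≥ 2, and λ ∈ (0, 1], and suppose (‖x‖^r + λ·‖y‖^r)^{1/r} ≤ ((1/(2π))∫₀^{2π} ‖x + e^{iθ}y‖^p dθ)^{1/p} for all x, y ∈ X. Then for every ε ∈ (0, 3], H_p^X(ε) ≥ (4^{1−r}·λ/r)·ε^r; in particular H_p^X(ε) ≥ (ε/K)^r with K := (r·4^{r−1}/λ)^{1/r} ≥ 1. -/
/-- The modulus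
`H_p^X(ε) = inf{((1/(2π))∫₀^{2π}‖x + e^{iθ}y‖^p dθ)^{1/p} − 1 : ‖x‖ = 1, ‖y‖ = ε}`. -/
noncomputable def HModPL (X : Type*) [NormedAddCommGroup X] [NormedSpace ℂ X] (p ε : ℝ) : ℝ :=
  sInf {d : ℝ | ∃ x y : X, ‖x‖ = 1 ∧ ‖y‖ = ε ∧
    d = ((1 / (2 * Real.pi)) *
      ∫ θ in (0:ℝ)..(2 * Real.pi), ‖x + Complex.exp (θ * Complex.I) • y‖ ^ p) ^ (1 / p) - 1}

/-- Tangent-line bound for `u ↦ u ^ r` on `[1, 4]`. -/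
theorem rpow_sub_one_le_of_le_four {r u : ℝ} (hr : 1 ≤ r) (hu1 : 1 ≤ u) (hu4 : u ≤ 4) :
    u ^ r - 1 ≤ r * 4 ^ (r - 1) * (u - 1) := by
  have hu0 : 0 < u := by linarith
  have hinv : 0 < u⁻¹ := inv_pos.mpr hu0
  have bernoulli : 1 + r * (u⁻¹ - 1) ≤ (u ^ r)⁻¹ := by
    have := one_add_mul_self_le_rpow_one_add (s := u⁻¹ - 1) (by linarith) hr
    rwa [add_sub_cancel, Real.inv_rpow hu0.le] at this
  have hpow : 0 < u ^ r := Real.rpow_pos_of_pos hu0 r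
  have hscaled := mul_le_mul_of_nonneg_left bernoulli hpow.le
  rw [mul_inv_cancel₀ hpow.ne'] at hscaled
  have hmul : u ^ r * u⁻¹ = u ^ (r - 1) := by
    rw [Real.rpow_sub_one hu0.ne', div_eq_mul_inv]
  have hsplit : u ^ r = u ^ (r - 1) * u := by
    rw [← hmul, inv_mul_cancel_right₀ hu0.ne']
  have hmono : u ^ (r - 1) ≤ 4 ^ (r - 1) :=
    Real.rpow_le_rpow hu0.le hu4 (by linarith)
  calc u ^ r - 1 ≤ r * (u ^ r - u ^ r * u⁻¹) := by linarith
    _ = r * u ^ (r - 1) * (u - 1) := by rw [hmul, hsplit]; ring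
    _ ≤ r * 4 ^ (r - 1) * (u - 1) := by
      have : 0 ≤ u - 1 := by linarith
      gcongr

/-- If `(‖x‖^r + λ‖y‖^r)^{1/r} ≤ ((1/(2π))∫₀^{2π}‖x + e^{iθ}y‖^p dθ)^{1/p}` for all `x, y`,
then for every `ε ∈ (0,3]` one has `H_p^X(ε) ≥ 4^{1−r}·λ/r·ε^r`; in particular
`H_p^X(ε) ≥ (ε/K)^r` with `K = (r·4^{r−1}/λ)^{1/r} ≥ 1`. -/
theorem HModPL_lower_bound_of_r_uniformly_PL_convex
    (X : Type*) [NormedAddCommGroup X] [NormedSpace ℂ X] (hX : ∃ x : X, ‖x‖ = 1)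
    (p r lam : ℝ) (hp : 0 < p) (hr : 2 ≤ r) (hlam0 : 0 < lam) (hlam1 : lam ≤ 1)
    (hPL : ∀ x y : X, (‖x‖ ^ r + lam * ‖y‖ ^ r) ^ (1 / r) ≤
      ((1 / (2 * Real.pi)) *
        ∫ θ in (0:ℝ)..(2 * Real.pi), ‖x + Complex.exp (θ * Complex.I) • y‖ ^ p) ^ (1 / p)) :
    1 ≤ (r * 4 ^ (r - 1) / lam) ^ (1 / r) ∧
    ∀ ε : ℝ, 0 < ε → ε ≤ 3 →
      (4:ℝ) ^ (1 - r) * lam / r * ε ^ r ≤ HModPL X p ε ∧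
      (ε / (r * 4 ^ (r - 1) / lam) ^ (1 / r)) ^ r ≤ HModPL X p ε := by
  have hr0 : 0 < r := by linarith
  have h4 : (1 : ℝ) ≤ 4 ^ (r - 1) := Real.one_le_rpow (by norm_num) (by linarith)
  have hK : 1 ≤ r * 4 ^ (r - 1) / lam := by
    rw [le_div_iff₀ hlam0]
    nlinarith
  refine ⟨Real.one_le_rpow hK (by positivity), fun ε hε0 hε3 => ?_⟩
  have hfirst : (4 : ℝ) ^ (1 - r) * lam / r * ε ^ r = lam * ε ^ r / (r * 4 ^ (r - 1)) := by
    rw [← neg_sub r 1, Real.rpow_neg (by norm_num)]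
    field_simp
  have hsecond : (ε / (r * 4 ^ (r - 1) / lam) ^ (1 / r)) ^ r =
      lam * ε ^ r / (r * 4 ^ (r - 1)) := by
    rw [Real.div_rpow hε0.le (by positivity), ← Real.rpow_mul (by positivity),
      one_div_mul_cancel hr0.ne', Real.rpow_one]
    field_simp
  rw [hfirst, hsecond, and_self]
  obtain ⟨x₀, hx₀⟩ := hX
  refine le_csInf ⟨_, x₀, (ε : ℂ) • x₀, hx₀, ?_, rfl⟩ ?_
  · rw [norm_smul, hx₀, Complex.norm_real, Real.norm_of_nonneg hε0.le, mul_one]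
  rintro d ⟨x, y, hx, hy, rfl⟩
  have hxy := hPL x y
  rw [hx, hy, Real.one_rpow] at hxy
  refine le_trans ?_ (sub_le_sub_right hxy 1)
  have hεr : 0 < ε ^ r := Real.rpow_pos_of_pos hε0 r
  have hbound : 1 + lam * ε ^ r ≤ 4 ^ r := by
    have hε : ε ^ r ≤ 3 ^ r := Real.rpow_le_rpow hε0.le hε3 hr0.le
    have hsum := Real.add_rpow_le_rpow_add (a := 1) (b := 3) (by norm_num) (by norm_num)
      (show 1 ≤ r by linarith)
    rw [Real.one_rpow] at hsum
    norm_num at hsum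
    nlinarith
  have hu1 : 1 ≤ (1 + lam * ε ^ r) ^ (1 / r) :=
    Real.one_le_rpow (by nlinarith) (by positivity)
  have hu4 : (1 + lam * ε ^ r) ^ (1 / r) ≤ 4 := by
    rw [one_div]
    exact (Real.rpow_inv_le_iff_of_pos (by positivity) (by norm_num) hr0).mpr hbound
  have key := rpow_sub_one_le_of_le_four (r := r) (by linarith) hu1 hu4
  rw [← Real.rpow_mul (by positivity), one_div_mul_cancel hr0.ne', Real.rpow_one,
    add_sub_cancel_left] at key
  rwa [div_le_iff₀' (by positivity)]
end

section
/- Let X be a complex normed space, let p > 0, r ≥ 2, and suppose there exists K ≥ 1 such that (ε/K)^r ≤ K·H_p^X(ε) for every ε ∈ (0, 1/K]. Then, with λ := 1/K^{r+1} ∈ (0, 1], for all x, y ∈ X with ‖x‖ = 1 and 0 < ‖y‖ ≤ 1/K: (1 + λ·‖y‖^r)^{1/r} ≤ 1 + λ·‖y‖^r ≤ ((1/(2π))∫₀^{2π} ‖x + e^{iθ}y‖^p dθ)^{1/p}. -/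
/-- Every pair of vectors with `‖x‖ = 1`, `‖y‖ = ε` bounds the modulus `H_p^X(ε)` from above. -/
theorem HModPL_le {X : Type*} [NormedAddCommGroup X] [NormedSpace ℂ X] (p : ℝ) {x : X} (y : X)
    (hx : ‖x‖ = 1) :
    HModPL X p ‖y‖ ≤ ((1 / (2 * Real.pi)) *
      ∫ θ in (0:ℝ)..(2 * Real.pi), ‖x + Complex.exp (θ * Complex.I) • y‖ ^ p) ^ (1 / p) - 1 := by
  refine csInf_le ⟨-1, ?_⟩ ⟨x, y, hx, rfl, rfl⟩
  rintro d ⟨u, v, -, -, rfl⟩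
  have hint : 0 ≤ ∫ θ in (0:ℝ)..(2 * Real.pi), ‖u + Complex.exp (θ * Complex.I) • v‖ ^ p :=
    intervalIntegral.integral_nonneg (by positivity) fun θ _ => by positivity
  have hpow := Real.rpow_nonneg (mul_nonneg (by positivity : 0 ≤ 1 / (2 * Real.pi)) hint) (1 / p)
  linarith

/-- If `(ε/K)^r ≤ K·H_p^X(ε)` for all `ε ∈ (0, 1/K]` with `K ≥ 1`, then with
`λ := 1/K^{r+1} ∈ (0,1]`, for all `x, y` with `‖x‖ = 1` and `0 < ‖y‖ ≤ 1/K`,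
`(1 + λ‖y‖^r)^{1/r} ≤ 1 + λ‖y‖^r ≤ ((1/(2π))∫₀^{2π}‖x + e^{iθ}y‖^p dθ)^{1/p}`. -/
theorem PL_convexity_inequality_of_HModPL_bound
    (X : Type*) [NormedAddCommGroup X] [NormedSpace ℂ X]
    (p r K : ℝ) (hp : 0 < p) (hr : 2 ≤ r) (hK : 1 ≤ K)
    (hH : ∀ ε : ℝ, 0 < ε → ε ≤ 1 / K → (ε / K) ^ r ≤ K * HModPL X p ε) :
    (0 < 1 / K ^ (r + 1) ∧ 1 / K ^ (r + 1) ≤ 1) ∧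
    ∀ x y : X, ‖x‖ = 1 → 0 < ‖y‖ → ‖y‖ ≤ 1 / K →
      (1 + (1 / K ^ (r + 1)) * ‖y‖ ^ r) ^ (1 / r) ≤ 1 + (1 / K ^ (r + 1)) * ‖y‖ ^ r ∧
      1 + (1 / K ^ (r + 1)) * ‖y‖ ^ r ≤
        ((1 / (2 * Real.pi)) *
          ∫ θ in (0:ℝ)..(2 * Real.pi), ‖x + Complex.exp (θ * Complex.I) • y‖ ^ p) ^ (1 / p) := by
  have hK0 : 0 < K := by linarith
  refine ⟨⟨by positivity, ?_⟩, fun x y hx hy hyK => ⟨?_, ?_⟩⟩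
  · rw [div_le_one (by positivity)]
    exact Real.one_le_rpow hK (by linarith)
  · refine Real.rpow_le_self_of_one_le ?_ ?_
    · exact le_add_of_nonneg_right (by positivity)
    · rw [div_le_one (by linarith)]
      linarith
  · have hscale : (1 / K ^ (r + 1)) * ‖y‖ ^ r = (‖y‖ / K) ^ r / K := by
      rw [Real.div_rpow hy.le hK0.le, Real.rpow_add_one hK0.ne']
      field_simp
    have hmod : (‖y‖ / K) ^ r / K ≤ HModPL X p ‖y‖ := by
      rw [div_le_iff₀' hK0]
      exact hH ‖y‖ hy hyK
    linarith [HModPL_le p y hx]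
end

section
/- Let 1 < p < q < ∞ and let r be a real number with 0 < r ≤ √((p−1)/(q−1)). Then for every complex Banach space X and all x, y ∈ X, ((1/(2π))∫₀^{2π} ‖x + r·e^{iθ}y‖^q dθ)^{1/q} ≤ ((1/(2π))∫₀^{2π} ‖x + e^{iθ}y‖^p dθ)^{1/p}. -/
section

open Real Set MeasureTheory intervalIntegral

/-- Differentiation under an interval integral with a jointly continuous derivative. -/
theorem hasDerivAt_intervalIntegral_of_continuousOn {F F' : ℝ → ℝ → ℝ} {S : Set ℝ} (hS : IsOpen S)
    {a b s₀ : ℝ} (hs₀ : s₀ ∈ S) (hF : ∀ s ∈ S, Continuous (F s))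
    (hF' : ContinuousOn (Function.uncurry F') (S ×ˢ univ))
    (hd : ∀ s ∈ S, ∀ θ, HasDerivAt (fun s => F s θ) (F' s θ) s) :
    HasDerivAt (fun s => ∫ θ in a..b, F s θ) (∫ θ in a..b, F' s₀ θ) s₀ := by
  obtain ⟨K, hK, hKS, hKc⟩ := exists_mem_nhds_isCompact_mapsTo continuous_id (hS.mem_nhds hs₀)
  obtain ⟨C, hC⟩ := (hKS.prod (isCompact_uIcc (a := a) (b := b))).exists_bound_of_continuousOn
    (hF'.mono (prod_mono hKc (subset_univ _)))
  have hcont : ∀ s ∈ S, Continuous (F' s) := fun s hs =>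
    hF'.comp_continuous (Continuous.prodMk_right s) fun θ => ⟨hs, mem_univ _⟩
  refine (hasDerivAt_integral_of_dominated_loc_of_deriv_le (bound := fun _ => C) hK ?_
    ((hF s₀ hs₀).intervalIntegrable _ _) (hcont s₀ hs₀).aestronglyMeasurable ?_
    intervalIntegrable_const ?_).2
  · filter_upwards [hK] with s hs using (hF s (hKc hs)).aestronglyMeasurable
  · exact .of_forall fun θ hθ s hs => hC (s, θ) ⟨hs, uIoc_subset_uIcc hθ⟩
  · exact .of_forall fun θ _ s hs => hd s (hKc hs) θ

/-- Wirtinger's inequality. -/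
theorem integral_sq_le_integral_deriv_sq {f f' : ℝ → ℝ} (hf : ∀ θ, HasDerivAt f (f' θ) θ)
    (hf' : Continuous f') (hper : f (2 * π) = f 0) (hmean : ∫ θ in (0 : ℝ)..2 * π, f θ = 0) :
    ∫ θ in (0 : ℝ)..2 * π, f θ ^ 2 ≤ ∫ θ in (0 : ℝ)..2 * π, f' θ ^ 2 := by
  have hfc : Continuous f := continuous_iff_continuousAt.2 fun θ => (hf θ).continuousAt
  have hpi : (0 : ℝ) < 2 * π := by positivity
  have hL : ∀ g : ℝ → ℝ, Continuous g →
      MemLp (fun θ => (g θ : ℂ)) 2 (volume.restrict (Ioc 0 (2 * π))) := fun g hg => by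
    have hg' : Continuous fun θ => (g θ : ℂ) := by fun_prop
    obtain ⟨C, hC⟩ := (isCompact_Icc (a := (0 : ℝ)) (b := 2 * π)).exists_bound_of_continuousOn
      hg'.continuousOn
    exact MemLp.of_bound hg'.aestronglyMeasurable C ((ae_restrict_iff' measurableSet_Ioc).2
      (.of_forall fun θ hθ => hC θ (Ioc_subset_Icc_self hθ)))
  have h1 := hasSum_sq_fourierCoeffOn hpi (hL f hfc)
  have h2 := hasSum_sq_fourierCoeffOn hpi (hL f' hf')
  have h3 := hasSum_le (fun n => ?_) h1 h2
  · simp only [Complex.norm_real, Real.norm_eq_abs, sq_abs, sub_zero, smul_eq_mul] at h3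
    exact le_of_mul_le_mul_left h3 (by positivity)
  rcases eq_or_ne n 0 with rfl | hn
  · have : fourierCoeffOn hpi (fun θ => (f θ : ℂ)) 0 = 0 := by
      rw [fourierCoeffOn_eq_integral]
      simp [intervalIntegral.integral_ofReal, hmean]
    rw [this, norm_zero, zero_pow two_ne_zero]
    positivity
  · rw [fourierCoeffOn_of_hasDerivAt hpi hn (fun θ _ => (hf θ).ofReal_comp)
      ((by fun_prop : Continuous fun θ => (f' θ : ℂ)).intervalIntegrable _ _), hper]
    have hn1 : (1 : ℝ) ≤ |(n : ℝ)| := by exact_mod_cast Int.one_le_abs hn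
    gcongr
    simp only [sub_self, mul_zero, zero_sub, norm_mul, norm_div, norm_neg, norm_one,
      Complex.norm_I, Complex.norm_intCast, Complex.norm_real, Complex.norm_ofNat, mul_one,
      Real.norm_eq_abs, Complex.ofReal_mul, Complex.ofReal_ofNat, abs_of_pos pi_pos]
    have hy := norm_nonneg (fourierCoeffOn hpi (fun θ => (f' θ : ℂ)) n)
    generalize ‖fourierCoeffOn hpi (fun θ => (f' θ : ℂ)) n‖ = y at *
    rw [← Complex.ofReal_ofNat, ← Complex.ofReal_mul, ← Complex.ofReal_sub, Complex.norm_real,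
      sub_zero, Real.norm_of_nonneg hpi.le]
    have hy' : 1 / (2 * π * |(n : ℝ)|) * (2 * π * y) = y / |(n : ℝ)| := by field_simp
    rw [hy']
    exact div_le_self hy hn1

/-- The derivative of twice the entropy minus the Fisher information along the heat flow on the
circle has a sign. -/
theorem integral_fisher_dissipation_nonneg {u u₁ u₂ u₃ : ℝ → ℝ} (hpos : ∀ θ, 0 < u θ)
    (hu : ∀ θ, HasDerivAt u (u₁ θ) θ) (hu₁ : ∀ θ, HasDerivAt u₁ (u₂ θ) θ)
    (hu₂ : ∀ θ, HasDerivAt u₂ (u₃ θ) θ) (hu₃ : Continuous u₃)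
    (hper : u (2 * π) = u 0) (hper₁ : u₁ (2 * π) = u₁ 0) (hper₂ : u₂ (2 * π) = u₂ 0) :
    0 ≤ ∫ θ in (0 : ℝ)..2 * π, (2 * u₂ θ * (log (u θ) + 1) - 2 * u₁ θ * u₃ θ / u θ
      + u₁ θ ^ 2 * u₂ θ / u θ ^ 2) := by
  have cu : Continuous u := continuous_iff_continuousAt.2 fun θ => (hu θ).continuousAt
  have cu₁ : Continuous u₁ := continuous_iff_continuousAt.2 fun θ => (hu₁ θ).continuousAt
  have cu₂ : Continuous u₂ := continuous_iff_continuousAt.2 fun θ => (hu₂ θ).continuousAt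
  have hne : ∀ θ, u θ ≠ 0 := fun θ => (hpos θ).ne'
  have hsq : ∀ θ, √(u θ) ≠ 0 := fun θ => (sqrt_pos.2 (hpos θ)).ne'
  let w₁ : ℝ → ℝ := fun θ => u₁ θ / (2 * √(u θ))
  let w₂ : ℝ → ℝ := fun θ => u₂ θ / (2 * √(u θ)) - u₁ θ ^ 2 / (4 * u θ * √(u θ))
  have hw : ∀ θ, HasDerivAt (fun θ => √(u θ)) (w₁ θ) θ := fun θ => (hu θ).sqrt (hne θ)
  have hw₁ : ∀ θ, HasDerivAt w₁ (w₂ θ) θ := fun θ => by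
    have h := (hu₁ θ).div ((hw θ).const_mul 2) (by simpa using hsq θ)
    refine h.congr_deriv ?_
    have h0 := sq_sqrt (hpos θ).le
    have h1 := hsq θ
    simp only [w₁, w₂]
    generalize √(u θ) = v at *
    rw [← h0]
    field_simp
    ring
  have cw₁ : Continuous w₁ := cu₁.div (by fun_prop) (by simpa using hsq)
  have cw₂ : Continuous w₂ := (cu₂.div (by fun_prop) (by simpa using hsq)).sub
    ((cu₁.pow 2).div (by fun_prop) (by simp [hne, hsq]))
  have hwirt := integral_sq_le_integral_deriv_sq hw₁ cw₂ (by simp [w₁, hper, hper₁])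
    (by rw [integral_eq_sub_of_hasDerivAt (fun θ _ => hw θ) (cw₁.intervalIntegrable _ _), hper,
      sub_self])
  let Φ : ℝ → ℝ := fun θ => 2 * u₁ θ * (log (u θ) + 1) - 2 * u₁ θ * u₂ θ / u θ
    + 1 / 3 * (u₁ θ ^ 3 / u θ ^ 2)
  let φ : ℝ → ℝ := fun θ => 2 * u₂ θ * (log (u θ) + 1) + 2 * u₁ θ ^ 2 / u θ - 2 * u₂ θ ^ 2 / u θ
    - 2 * u₁ θ * u₃ θ / u θ + 3 * u₁ θ ^ 2 * u₂ θ / u θ ^ 2 - 2 / 3 * (u₁ θ ^ 4 / u θ ^ 3)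
  have hΦ : ∀ θ, HasDerivAt Φ (φ θ) θ := fun θ => by
    have h := ((((hu₁ θ).const_mul 2).mul (((hu θ).log (hne θ)).add_const 1)).sub
      ((((hu₁ θ).const_mul 2).mul (hu₂ θ)).div (hu θ) (hne θ))).add
      ((((hu₁ θ).pow 3).div ((hu θ).pow 2) (pow_ne_zero 2 (hne θ))).const_mul (1 / 3))
    refine h.congr_deriv ?_
    have := hne θ
    simp only [φ, Pi.mul_apply, Pi.pow_apply]
    field_simp
    ring
  have clog : Continuous fun θ => log (u θ) := cu.log hne
  have cφ : Continuous φ := by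
    simp only [φ]
    fun_prop (disch := simp [hne])
  have hφ : ∫ θ in (0 : ℝ)..2 * π, φ θ = 0 := by
    rw [integral_eq_sub_of_hasDerivAt (fun θ _ => hΦ θ) (cφ.intervalIntegrable _ _)]
    simp [Φ, hper, hper₁, hper₂]
  have hle : ∫ θ in (0 : ℝ)..2 * π, (φ θ + (8 * w₂ θ ^ 2 - 8 * w₁ θ ^ 2)) ≤
      ∫ θ in (0 : ℝ)..2 * π, (2 * u₂ θ * (log (u θ) + 1) - 2 * u₁ θ * u₃ θ / u θ
      + u₁ θ ^ 2 * u₂ θ / u θ ^ 2) := by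
    apply integral_mono_on (by positivity)
      (Continuous.intervalIntegrable (by fun_prop) _ _)
      (Continuous.intervalIntegrable (by fun_prop (disch := simp [hne])) _ _)
    intro θ _
    have h0 := sq_sqrt (hpos θ).le
    have h1 := hsq θ
    have h2 : 0 ≤ 1 / 6 * (u₁ θ ^ 4 / u θ ^ 3) := by have := hpos θ; positivity
    rw [← sub_nonneg]
    refine h2.trans_eq ?_
    simp only [φ, w₁, w₂]
    generalize log (u θ) = L
    generalize √(u θ) = v at *
    rw [← h0]
    field_simp
    ring
  refine le_trans ?_ hle
  rw [intervalIntegral.integral_add (cφ.intervalIntegrable _ _)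
    (Continuous.intervalIntegrable (by fun_prop) _ _), hφ, intervalIntegral.integral_sub
    (Continuous.intervalIntegrable (by fun_prop) _ _)
    (Continuous.intervalIntegrable (by fun_prop) _ _), intervalIntegral.integral_const_mul,
    intervalIntegral.integral_const_mul]
  linarith

/-- The `k`-th angular derivative of the (real part of the) trigonometric polynomial
`∑ c n * exp (i n θ)` after running the heat flow for time `-log τ`. -/
noncomputable def trigFlow (s : Finset ℤ) (c : ℤ → ℂ) (k : ℕ) (τ θ : ℝ) : ℝ :=
  (∑ n ∈ s, c n * (n * Complex.I) ^ k * (τ : ℂ) ^ (n.natAbs ^ 2) * Complex.exp (n * θ * Complex.I)).re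

section trigFlow

theorem natCast_natAbs_sq (n : ℤ) : ((n.natAbs ^ 2 : ℕ) : ℂ) = (n : ℂ) ^ 2 := by
  rw [← Int.cast_natCast, Nat.cast_pow, Int.natAbs_sq, Int.cast_pow]

variable (s : Finset ℤ) (c : ℤ → ℂ)

theorem continuous_trigFlow (k : ℕ) : Continuous (Function.uncurry (trigFlow s c k)) := by
  unfold trigFlow Function.uncurry
  fun_prop

theorem hasDerivAt_trigFlow_angle (k : ℕ) (τ θ : ℝ) :
    HasDerivAt (trigFlow s c k τ) (trigFlow s c (k + 1) τ θ) θ := by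
  have h : HasDerivAt (fun z : ℂ => ∑ n ∈ s, c n * (n * Complex.I) ^ k * (τ : ℂ) ^ (n.natAbs ^ 2) *
      Complex.exp (n * z * Complex.I)) (∑ n ∈ s, c n * (n * Complex.I) ^ (k + 1) *
        (τ : ℂ) ^ (n.natAbs ^ 2) * Complex.exp (n * θ * Complex.I)) θ := by
    refine HasDerivAt.fun_sum fun n _ => ?_
    refine ((((hasDerivAt_id (θ : ℂ)).const_mul (n : ℂ)).mul_const Complex.I).cexp.const_mul
      (c n * (n * Complex.I) ^ k * (τ : ℂ) ^ (n.natAbs ^ 2))).congr_deriv ?_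
    simp only [id]
    ring
  exact h.real_of_complex

theorem hasDerivAt_trigFlow_time (k : ℕ) {τ : ℝ} (hτ : τ ≠ 0) (θ : ℝ) :
    HasDerivAt (fun τ => trigFlow s c k τ θ) (-(trigFlow s c (k + 2) τ θ / τ)) τ := by
  have h : HasDerivAt (fun z : ℂ => ∑ n ∈ s, c n * (n * Complex.I) ^ k * z ^ (n.natAbs ^ 2) *
      Complex.exp (n * θ * Complex.I)) (∑ n ∈ s, -(c n * (n * Complex.I) ^ (k + 2) *
        (τ : ℂ) ^ (n.natAbs ^ 2) * Complex.exp (n * θ * Complex.I) / τ)) τ := by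
    refine HasDerivAt.fun_sum fun n _ => ?_
    refine (((hasDerivAt_pow (n.natAbs ^ 2) (τ : ℂ)).const_mul
      (c n * (n * Complex.I) ^ k)).mul_const _).congr_deriv ?_
    have hτ' : (τ : ℂ) ≠ 0 := by exact_mod_cast hτ
    have hn := natCast_natAbs_sq n
    rw [hn, pow_add _ k 2, mul_pow _ _ 2, Complex.I_sq]
    rcases eq_or_ne n 0 with rfl | hn0
    · simp
    · have : (τ : ℂ) ^ (n.natAbs ^ 2) = (τ : ℂ) ^ (n.natAbs ^ 2 - 1) * τ := by
        rw [← pow_succ, Nat.sub_add_cancel (Nat.one_le_iff_ne_zero.2 (by simpa using hn0))]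
      rw [this]
      field_simp
  refine h.real_of_complex.congr_deriv ?_
  rw [Finset.sum_neg_distrib, ← Finset.sum_div, Complex.neg_re, Complex.div_ofReal_re, trigFlow]

theorem trigFlow_periodic (k : ℕ) (τ : ℝ) : Function.Periodic (trigFlow s c k τ) (2 * π) := by
  intro θ
  unfold trigFlow
  congr 1
  refine Finset.sum_congr rfl fun n _ => ?_
  have : (n : ℂ) * ((θ + 2 * π : ℝ) : ℂ) * Complex.I
      = n * θ * Complex.I + n * (2 * π * Complex.I) := by
    push_cast
    ring
  rw [this, Complex.exp_add, Complex.exp_int_mul_two_pi_mul_I, mul_one]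

theorem trigFlow_zero_eq (θ : ℝ) : trigFlow s c 0 0 θ = trigFlow s c 0 0 0 := by
  unfold trigFlow
  congr 1
  refine Finset.sum_congr rfl fun n _ => ?_
  rcases eq_or_ne n 0 with rfl | hn <;> simp [*]

theorem trigFlow_one_zero (θ : ℝ) : trigFlow s c 1 0 θ = 0 := by
  unfold trigFlow
  rw [Finset.sum_eq_zero, Complex.zero_re]
  intro n _
  rcases eq_or_ne n 0 with rfl | hn <;> simp [*]

theorem trigFlow_eq_add (θ : ℝ) : trigFlow s c 0 1 θ =
    trigFlow s c 0 0 θ + trigFlow s (fun n => c n / (n * Complex.I)) 1 1 θ := by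
  unfold trigFlow
  rw [← Complex.add_re, ← Finset.sum_add_distrib]
  congr 1
  refine Finset.sum_congr rfl fun n _ => ?_
  rcases eq_or_ne n 0 with rfl | hn
  · simp
  · have : (n : ℂ) ≠ 0 := by exact_mod_cast hn
    simp [hn]

theorem integral_trigFlow_succ (k : ℕ) (τ : ℝ) :
    ∫ θ in (0 : ℝ)..2 * π, trigFlow s c (k + 1) τ θ = 0 := by
  rw [integral_eq_sub_of_hasDerivAt (fun θ _ => hasDerivAt_trigFlow_angle s c k τ θ)
    (((continuous_trigFlow s c (k + 1)).uncurry_left τ).intervalIntegrable _ _),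
    (trigFlow_periodic s c k τ).eq, sub_self]

theorem integral_trigFlow :
    ∫ θ in (0 : ℝ)..2 * π, trigFlow s c 0 1 θ = 2 * π * trigFlow s c 0 0 0 := by
  have hi : ∀ c k τ, IntervalIntegrable (trigFlow s c k τ) volume 0 (2 * π) := fun c k τ =>
    ((continuous_trigFlow s c k).uncurry_left τ).intervalIntegrable _ _
  simp_rw [trigFlow_eq_add s c]
  rw [intervalIntegral.integral_add (hi _ _ _) (hi _ _ _), integral_trigFlow_succ, add_zero]
  simp_rw [trigFlow_zero_eq s c]
  simp

/-- The heat flow is the average over Gaussian translations. -/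
theorem trigFlow_eq_integral_gaussian {τ : ℝ} (h0 : 0 < τ) (h1 : τ ≤ 1) (θ : ℝ) :
    trigFlow s c 0 τ θ = ∫ x, trigFlow s c 0 1 (θ + x)
      ∂(ProbabilityTheory.gaussianReal 0 (-2 * log τ).toNNReal) := by
  set μ := ProbabilityTheory.gaussianReal 0 (-2 * log τ).toNNReal
  have hint : ∀ n : ℤ, Integrable (fun x : ℝ => c n * Complex.exp (n * (θ + x) * Complex.I)) μ :=
    fun n => Integrable.of_bound (C := ‖c n‖) (by fun_prop) (.of_forall fun x => by
      rw [norm_mul]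
      refine mul_le_of_le_one_right (norm_nonneg _) (le_of_eq ?_)
      have : (n : ℂ) * (θ + x) * Complex.I = ((n * (θ + x) : ℝ) : ℂ) * Complex.I := by push_cast; rfl
      rw [this, Complex.norm_exp_ofReal_mul_I])
  have hchar : ∀ n : ℤ, ∫ x, Complex.exp (n * x * Complex.I) ∂μ = (τ : ℂ) ^ (n.natAbs ^ 2) := by
    intro n
    have h := ProbabilityTheory.charFun_gaussianReal (μ := 0) (v := (-2 * log τ).toNNReal) (n : ℝ)
    rw [charFun_apply_real] at h
    push_cast at h
    rw [h]
    have hv : (((-2 * log τ).toNNReal : ℝ) : ℂ) = ((-2 * log τ : ℝ) : ℂ) := by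
      rw [Real.coe_toNNReal _ (by nlinarith [log_nonpos h0.le h1])]
    rw [hv]
    have hn := natCast_natAbs_sq n
    have ht : (τ : ℂ) = Complex.exp (log τ : ℝ) := by
      rw [← Complex.ofReal_exp, exp_log h0]
    conv_rhs => rw [ht]
    rw [← Complex.exp_nat_mul, hn]
    congr 1
    push_cast
    ring
  have hre : ∀ x : ℝ, trigFlow s c 0 1 (θ + x) =
      RCLike.re (∑ n ∈ s, c n * Complex.exp (n * (θ + x) * Complex.I)) := fun x => by
    simp [trigFlow]
  simp_rw [hre]
  rw [integral_re (integrable_finsetSum _ fun n _ => hint n), integral_finsetSum _ fun n _ => hint n]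
  unfold trigFlow
  refine congrArg Complex.re (Finset.sum_congr rfl fun n _ => ?_)
  have hexp : ∀ x : ℝ, c n * Complex.exp (n * (θ + x) * Complex.I)
      = c n * Complex.exp (n * θ * Complex.I) * Complex.exp (n * x * Complex.I) := fun x => by
    rw [mul_assoc (c n), ← Complex.exp_add]
    ring_nf
  simp_rw [hexp]
  rw [MeasureTheory.integral_const_mul, hchar]
  ring

theorem le_trigFlow {m : ℝ} (hm : ∀ θ, m ≤ trigFlow s c 0 1 θ) {τ : ℝ} (hτ : τ ∈ Icc (0 : ℝ) 1)
    (θ : ℝ) : m ≤ trigFlow s c 0 τ θ := by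
  have hpos : ∀ τ ∈ Ioo (0 : ℝ) 1, m ≤ trigFlow s c 0 τ θ := fun τ hτ => by
    rw [trigFlow_eq_integral_gaussian s c hτ.1 hτ.2.le]
    have hc : Continuous fun x => trigFlow s c 0 1 (θ + x) :=
      ((continuous_trigFlow s c 0).uncurry_left 1).comp (by fun_prop)
    obtain ⟨C, hC⟩ : ∃ C, ∀ x, ‖trigFlow s c 0 1 x‖ ≤ C := by
      obtain ⟨C, hC⟩ := isBounded_iff_forall_norm_le.1 ((trigFlow_periodic s c 0 1).isBounded_of_continuous
        (by positivity) ((continuous_trigFlow s c 0).uncurry_left 1))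
      exact ⟨C, fun x => hC _ (mem_range_self x)⟩
    have hi : Integrable (fun x => trigFlow s c 0 1 (θ + x))
        (ProbabilityTheory.gaussianReal 0 (-2 * log τ).toNNReal) :=
      Integrable.of_bound hc.aestronglyMeasurable (C := C) (.of_forall fun x => hC _)
    simpa using integral_mono (integrable_const m) hi fun x => hm (θ + x)
  have hcl : IsClosed {τ | m ≤ trigFlow s c 0 τ θ} :=
    isClosed_le continuous_const ((continuous_trigFlow s c 0).uncurry_right θ)
  have := closure_minimal hpos hcl
  rw [closure_Ioo (by norm_num)] at this
  exact this hτ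

/-- Along the heat flow, twice the entropy minus the Fisher information is monotone. -/
theorem antitoneOn_entropy_sub_fisher {D : ℕ → ℝ → ℝ → ℝ}
    (hc : ∀ k, Continuous (Function.uncurry (D k)))
    (hpos : ∀ τ ∈ Icc (0 : ℝ) 1, ∀ θ, 0 < D 0 τ θ)
    (hθ : ∀ k τ θ, HasDerivAt (D k τ) (D (k + 1) τ θ) θ)
    (hτ : ∀ k τ, τ ≠ 0 → ∀ θ, HasDerivAt (fun τ => D k τ θ) (-(D (k + 2) τ θ / τ)) τ)
    (hp : ∀ k τ, D k τ (2 * π) = D k τ 0) :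
    AntitoneOn (fun τ => ∫ θ in (0 : ℝ)..2 * π,
      (2 * (D 0 τ θ * log (D 0 τ θ)) - D 1 τ θ ^ 2 / D 0 τ θ)) (Icc 0 1) := by
  let G : ℝ → ℝ → ℝ := fun τ θ => 2 * (D 0 τ θ * log (D 0 τ θ))
      - D 1 τ θ ^ 2 / D 0 τ θ
  let G' : ℝ → ℝ → ℝ := fun τ θ => -τ⁻¹ * (2 * D 2 τ θ * (log (D 0 τ θ) + 1)
    - 2 * D 1 τ θ * D 3 τ θ / D 0 τ θ
    + D 1 τ θ ^ 2 * D 2 τ θ / D 0 τ θ ^ 2)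
  have hlog : ContinuousOn (fun x : ℝ × ℝ => log (Function.uncurry (D 0) x))
      (Icc (0 : ℝ) 1 ×ˢ univ) :=
    (hc 0).continuousOn.log fun x hx => (hpos _ hx.1 _).ne'
  have hGc : ContinuousOn (Function.uncurry G) (Icc (0 : ℝ) 1 ×ˢ univ) :=
    (continuousOn_const.mul ((hc 0).continuousOn.mul hlog)).sub
      (((hc 1).continuousOn.pow 2).div (hc 0).continuousOn fun x hx => (hpos _ hx.1 _).ne')
  have hG'c : ContinuousOn (Function.uncurry G') (Ioo (0 : ℝ) 1 ×ˢ univ) := by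
    have hsub : Ioo (0 : ℝ) 1 ×ˢ (univ : Set ℝ) ⊆ Icc (0 : ℝ) 1 ×ˢ univ :=
      prod_mono Ioo_subset_Icc_self subset_rfl
    have hne : ∀ x ∈ Ioo (0 : ℝ) 1 ×ˢ (univ : Set ℝ), Function.uncurry (D 0) x ≠ 0 :=
      fun x hx => (hpos _ (hsub hx).1 _).ne'
    refine ((continuousOn_fst.inv₀ fun x hx => hx.1.1.ne').neg).mul (((((continuousOn_const.mul
      (hc 2).continuousOn).mul ((hlog.mono hsub).add continuousOn_const))).sub
      (((continuousOn_const.mul (hc 1).continuousOn).mul (hc 3).continuousOn).div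
        (hc 0).continuousOn hne)).add ((((hc 1).continuousOn.pow 2).mul (hc 2).continuousOn).div
        ((hc 0).continuousOn.pow 2) fun x hx => pow_ne_zero 2 (hne x hx)))
  have hsec : ∀ τ ∈ Icc (0 : ℝ) 1, Continuous (G τ) := fun τ ht =>
    hGc.comp_continuous (Continuous.prodMk_right τ) fun θ => ⟨ht, mem_univ _⟩
  have hderiv : ∀ τ ∈ Ioo (0 : ℝ) 1, HasDerivAt (fun τ => ∫ θ in (0 : ℝ)..2 * π, G τ θ)
      (∫ θ in (0 : ℝ)..2 * π, G' τ θ) τ := fun τ ht => by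
    refine hasDerivAt_intervalIntegral_of_continuousOn isOpen_Ioo ht
      (fun τ ht => hsec τ (Ioo_subset_Icc_self ht)) hG'c fun τ ht θ => ?_
    have hne := (hpos τ (Ioo_subset_Icc_self ht) θ).ne'
    have ht0 := ht.1.ne'
    have h0 := hτ 0 τ ht0 θ
    have h1 := hτ 1 τ ht0 θ
    refine (((h0.mul (h0.log hne)).const_mul 2).sub ((h1.pow 2).div h0 hne)).congr_deriv ?_
    simp only [G', Pi.pow_apply]
    field_simp
    ring
  suffices hanti : AntitoneOn (fun τ => ∫ θ in (0 : ℝ)..2 * π, G τ θ) (Icc 0 1) from hanti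
  refine antitoneOn_of_deriv_nonpos (convex_Icc 0 1) ?_ ?_ ?_
  · rw [continuousOn_iff_continuous_domRestrict]
    refine intervalIntegral.continuous_parametric_intervalIntegral_of_continuous'
      (f := fun (τ : Icc (0 : ℝ) 1) θ => G τ θ) ?_ _ _
    exact hGc.comp_continuous (f := fun x : Icc (0 : ℝ) 1 × ℝ => ((x.1 : ℝ), x.2)) (by fun_prop)
      fun x => ⟨x.1.2, mem_univ _⟩
  · rw [interior_Icc]
    exact fun τ ht => (hderiv τ ht).differentiableAt.differentiableWithinAt
  · rw [interior_Icc]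
    intro τ ht
    rw [(hderiv τ ht).deriv, intervalIntegral.integral_const_mul]
    refine mul_nonpos_of_nonpos_of_nonneg (by have := ht.1; simp; positivity) ?_
    exact integral_fisher_dissipation_nonneg (hpos τ (Ioo_subset_Icc_self ht))
      (hθ 0 τ) (hθ 1 τ)
      (hθ 2 τ) ((hc 3).uncurry_left τ) (hp 0 τ) (hp 1 τ) (hp 2 τ)

/-- The logarithmic Sobolev inequality on the circle for positive trigonometric polynomials. -/
theorem trigFlow_logSobolev {m : ℝ} (hm0 : 0 < m) (hm : ∀ θ, m ≤ trigFlow s c 0 1 θ) :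
    ∫ θ in (0 : ℝ)..2 * π, (2 * (trigFlow s c 0 1 θ * log (trigFlow s c 0 1 θ))
      - trigFlow s c 1 1 θ ^ 2 / trigFlow s c 0 1 θ) ≤
    2 * ((∫ θ in (0 : ℝ)..2 * π, trigFlow s c 0 1 θ) *
      log ((2 * π)⁻¹ * ∫ θ in (0 : ℝ)..2 * π, trigFlow s c 0 1 θ)) := by
  have hpos : ∀ τ ∈ Icc (0 : ℝ) 1, ∀ θ, 0 < trigFlow s c 0 τ θ := fun τ hτ θ =>
    hm0.trans_le (le_trigFlow s c hm hτ θ)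
  have hanti := antitoneOn_entropy_sub_fisher (continuous_trigFlow s c) hpos
    (hasDerivAt_trigFlow_angle s c) (fun k _ h => hasDerivAt_trigFlow_time s c k h)
    fun k τ => (trigFlow_periodic s c k τ).eq
  have h := hanti (by simp : (0 : ℝ) ∈ Icc (0 : ℝ) 1) (by simp : (1 : ℝ) ∈ Icc (0 : ℝ) 1) zero_le_one
  refine h.trans_eq ?_
  simp only [trigFlow_one_zero]
  simp_rw [trigFlow_zero_eq s c]
  rw [integral_trigFlow, intervalIntegral.integral_const]
  have : (2 * π)⁻¹ * (2 * π * trigFlow s c 0 0 0) = trigFlow s c 0 0 0 := by field_simp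
  rw [this]
  simp
  ring

end trigFlow

section trigApprox

theorem exists_trigFlow_add_const (s : Finset ℤ) (c : ℤ → ℂ) (hc : c 0 = 0) (A : ℝ) :
    ∃ (s' : Finset ℤ) (c' : ℤ → ℂ), (∀ θ, trigFlow s' c' 0 1 θ = A + trigFlow s c 0 1 θ) ∧
      ∀ θ, trigFlow s' c' 1 1 θ = trigFlow s c 1 1 θ := by
  classical
  have key : ∀ k θ, trigFlow (insert 0 (s.erase 0)) (Function.update c 0 A) k 1 θ
      = A * 0 ^ k + trigFlow s c k 1 θ := fun k θ => by
    unfold trigFlow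
    rw [Finset.sum_insert (Finset.notMem_erase 0 s), Complex.add_re]
    congr 1
    · rcases eq_or_ne k 0 with rfl | hk <;> simp [*]
    · congr 1
      rw [← Finset.sum_erase s (a := 0) (by simp [hc])]
      refine Finset.sum_congr rfl fun n hn => ?_
      rw [Function.update_of_ne (Finset.ne_of_mem_erase hn)]
  exact ⟨_, _, fun θ => by simpa using key 0 θ, fun θ => by simpa using key 1 θ⟩

theorem exists_trigFlow_near {g : ℝ → ℝ} (hg : Continuous g) (hper : Function.Periodic g (2 * π))
    {ε : ℝ} (hε : 0 < ε) :
    ∃ (s : Finset ℤ) (c : ℤ → ℂ), ∀ θ, |trigFlow s c 0 1 θ - g θ| ≤ ε := by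
  have : Fact (0 < 2 * π) := ⟨by positivity⟩
  have hper' : Function.Periodic (fun θ => (g θ : ℂ)) (2 * π) := fun θ => by simp [hper θ]
  let G : C(AddCircle (2 * π), ℂ) := ⟨hper'.lift, by
    refine (QuotientAddGroup.isQuotientMap_mk _).continuous_iff.2 ?_
    exact Complex.continuous_ofReal.comp hg⟩
  have hG : G ∈ (Submodule.span ℂ (range <| @fourier (2 * π))).topologicalClosure := by
    rw [span_fourier_closure_eq_top]
    trivial
  obtain ⟨h, hh, hd⟩ := Metric.mem_closure_iff.1 hG ε hε
  obtain ⟨c, rfl⟩ := Finsupp.mem_span_range_iff_exists_finsupp.1 hh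
  refine ⟨c.support, c, fun θ => ?_⟩
  have h1 := (ContinuousMap.dist_apply_le_dist (f := G) (θ : AddCircle (2 * π))).trans hd.le
  rw [dist_comm, Complex.dist_eq] at h1
  refine le_trans (le_of_eq ?_) ((Complex.abs_re_le_norm _).trans h1)
  have hGθ : G (θ : AddCircle (2 * π)) = g θ := rfl
  rw [Complex.sub_re, hGθ, Complex.ofReal_re]
  congr 2
  unfold trigFlow
  rw [Finsupp.sum, ContinuousMap.sum_apply]
  congr 1
  refine Finset.sum_congr rfl fun n _ => ?_
  rw [ContinuousMap.smul_apply, fourier_coe_apply, smul_eq_mul]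
  have hpi : (π : ℂ) ≠ 0 := by exact_mod_cast pi_ne_zero
  simp only [pow_zero, mul_one, Complex.ofReal_one, one_pow]
  congr 2
  push_cast
  field_simp

theorem exists_trigFlow_near_C1 {g g' : ℝ → ℝ} (hg : ∀ θ, HasDerivAt g (g' θ) θ)
    (hg' : Continuous g') (hper : Function.Periodic g (2 * π)) {ε : ℝ} (hε : 0 < ε) :
    ∃ (s : Finset ℤ) (c : ℤ → ℂ), (∀ θ, |trigFlow s c 0 1 θ - g θ| ≤ ε) ∧
      ∀ θ, |trigFlow s c 1 1 θ - g' θ| ≤ ε := by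
  have hpi : 0 < 2 * π := by positivity
  have hper' : Function.Periodic g' (2 * π) := fun θ => by
    have h1 : HasDerivAt g (g' (θ + 2 * π)) θ := by
      have := (hg (θ + 2 * π)).comp_add_const θ (2 * π)
      rwa [funext hper] at this
    exact h1.unique (hg θ)
  set δ : ℝ := min ε (ε / (2 * π)) / 2 with hδ
  have hδ0 : 0 < δ := by positivity
  obtain ⟨s, c, hc⟩ := exists_trigFlow_near hg' hper' hδ0
  let d : ℤ → ℂ := fun n => c n / (n * Complex.I)
  have hmean : |trigFlow s c 0 0 0| ≤ δ := by
    have h1 : ∫ θ in (0 : ℝ)..2 * π, (trigFlow s c 0 1 θ - g' θ) = 2 * π * trigFlow s c 0 0 0 := by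
      rw [intervalIntegral.integral_sub
        (((continuous_trigFlow s c 0).uncurry_left 1).intervalIntegrable _ _)
        (hg'.intervalIntegrable _ _), integral_trigFlow,
        integral_eq_sub_of_hasDerivAt (fun θ _ => hg θ) (hg'.intervalIntegrable _ _), hper.eq]
      ring
    have h2 := intervalIntegral.norm_integral_le_of_norm_le_const (a := 0) (b := 2 * π) (C := δ)
      (f := fun θ => trigFlow s c 0 1 θ - g' θ) fun θ _ => hc θ
    rw [h1, norm_mul, sub_zero, Real.norm_of_nonneg hpi.le, abs_of_pos hpi, mul_comm] at h2
    exact le_of_mul_le_mul_right h2 hpi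
  have hd : ∀ θ, |trigFlow s d 1 1 θ - g' θ| ≤ 2 * δ := fun θ => by
    have h1 := trigFlow_eq_add s c θ
    rw [trigFlow_zero_eq] at h1
    have h2 := abs_le.1 (hc θ)
    have h3 := abs_le.1 hmean
    rw [h1] at h2
    exact abs_le.2 ⟨by linarith, by linarith⟩
  obtain ⟨s', c', h0, h1⟩ := exists_trigFlow_add_const s d (by simp [d])
    (g 0 - trigFlow s d 0 1 0)
  refine ⟨s', c', fun θ => ?_, fun θ => ?_⟩
  · have hp : Function.Periodic (fun θ => trigFlow s' c' 0 1 θ - g θ) (2 * π) :=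
      (trigFlow_periodic s' c' 0 1).sub hper
    obtain ⟨y, hy, hθy⟩ := hp.exists_mem_Ico₀ hpi θ
    rw [hθy]
    have hder : ∀ θ, HasDerivAt (fun θ => trigFlow s' c' 0 1 θ - g θ)
        (trigFlow s' c' 1 1 θ - g' θ) θ := fun θ =>
      (hasDerivAt_trigFlow_angle s' c' 0 1 θ).sub (hg θ)
    have hmv := Convex.norm_image_sub_le_of_norm_hasDerivWithin_le (s := univ) (x := 0) (y := y)
      (fun x _ => (hder x).hasDerivWithinAt) (fun x _ => by rw [h1]; exact hd x) convex_univ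
      trivial trivial
    simp only [h0, sub_add_cancel, sub_self, sub_zero, Real.norm_eq_abs, abs_of_nonneg hy.1] at hmv ⊢
    refine hmv.trans ?_
    calc 2 * δ * y ≤ ε / (2 * π) * (2 * π) := by
          gcongr
          · exact hy.1
          · rw [hδ]; linarith [min_le_right ε (ε / (2 * π))]
          · exact hy.2.le
      _ = ε := by field_simp
  · rw [h1]
    refine (hd θ).trans ?_
    rw [hδ]; linarith [min_le_left ε (ε / (2 * π))]

open Filter Topology in
/-- The logarithmic Sobolev inequality on the circle. -/
theorem circle_logSobolev {g g' : ℝ → ℝ} (hg : ∀ θ, HasDerivAt g (g' θ) θ)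
    (hg' : Continuous g') (hper : Function.Periodic g (2 * π)) (hpos : ∀ θ, 0 < g θ) :
    ∫ θ in (0 : ℝ)..2 * π, (2 * (g θ * log (g θ)) - g' θ ^ 2 / g θ) ≤
    2 * ((∫ θ in (0 : ℝ)..2 * π, g θ) * log ((2 * π)⁻¹ * ∫ θ in (0 : ℝ)..2 * π, g θ)) := by
  have hgc : Continuous g := continuous_iff_continuousAt.2 fun θ => (hg θ).continuousAt
  have hpi : 0 < 2 * π := by positivity
  obtain ⟨m, hm0, hm⟩ : ∃ m, 0 < m ∧ ∀ θ, m ≤ g θ := by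
    obtain ⟨x, -, hx⟩ := (isCompact_Icc (a := (0 : ℝ)) (b := 2 * π)).exists_isMinOn
      (nonempty_Icc.2 hpi.le) hgc.continuousOn
    refine ⟨g x, hpos x, fun θ => ?_⟩
    obtain ⟨y, hy, hθy⟩ := hper.exists_mem_Ico₀ hpi θ
    rw [hθy]
    exact hx (Ico_subset_Icc_self hy)
  obtain ⟨M, hM⟩ := (isCompact_Icc (a := (0 : ℝ)) (b := 2 * π)).exists_bound_of_continuousOn
    hgc.continuousOn
  obtain ⟨M', hM'⟩ := (isCompact_Icc (a := (0 : ℝ)) (b := 2 * π)).exists_bound_of_continuousOn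
    hg'.continuousOn
  let ε : ℕ → ℝ := fun n => m / 2 * (1 / (n + 1))
  have hε0 : ∀ n, 0 < ε n := fun n => by positivity
  have hεm : ∀ n, ε n ≤ m / 2 := fun n =>
    mul_le_of_le_one_right (by positivity) (by rw [div_le_one (by positivity)]; simp)
  have hεt : Tendsto ε atTop (𝓝 0) := by
    simpa [ε] using tendsto_one_div_add_atTop_nhds_zero_nat.const_mul (m / 2)
  choose s c h0 h1 using fun n => exists_trigFlow_near_C1 hg hg' hper (hε0 n)
  have hlow : ∀ n θ, m / 2 ≤ trigFlow (s n) (c n) 0 1 θ := fun n θ => by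
    have := abs_le.1 (h0 n θ)
    linarith [hm θ, hεm n]
  have ht0 : ∀ θ, Tendsto (fun n => trigFlow (s n) (c n) 0 1 θ) atTop (𝓝 (g θ)) := fun θ =>
    tendsto_iff_dist_tendsto_zero.2 (squeeze_zero (fun _ => dist_nonneg) (fun n => h0 n θ) hεt)
  have ht1 : ∀ θ, Tendsto (fun n => trigFlow (s n) (c n) 1 1 θ) atTop (𝓝 (g' θ)) := fun θ =>
    tendsto_iff_dist_tendsto_zero.2 (squeeze_zero (fun _ => dist_nonneg) (fun n => h1 n θ) hεt)
  have hcont : ∀ n k, Continuous (trigFlow (s n) (c n) k 1) := fun n k =>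
    (continuous_trigFlow _ _ k).uncurry_left 1
  have hb0 : ∀ n, ∀ θ ∈ Icc 0 (2 * π), trigFlow (s n) (c n) 0 1 θ ∈ Icc (m / 2) (M + m / 2) :=
    fun n θ hθ => ⟨hlow n θ, by
      have := (abs_le.1 (h0 n θ)).2
      linarith [(abs_le.1 (hM θ hθ)).2, hεm n]⟩
  have hb1 : ∀ n, ∀ θ ∈ Icc 0 (2 * π), trigFlow (s n) (c n) 1 1 θ ∈
      Icc (-(M' + m / 2)) (M' + m / 2) := fun n θ hθ => by
    have := abs_le.1 (h1 n θ)
    have h2 := abs_le.1 (hM' θ hθ)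
    exact ⟨by linarith [hεm n], by linarith [hεm n]⟩
  have hlim : ∀ Ψ : ℝ × ℝ → ℝ, ContinuousOn Ψ (Ioi 0 ×ˢ univ) →
      Tendsto (fun n => ∫ θ in (0 : ℝ)..2 * π,
        Ψ (trigFlow (s n) (c n) 0 1 θ, trigFlow (s n) (c n) 1 1 θ)) atTop
        (𝓝 (∫ θ in (0 : ℝ)..2 * π, Ψ (g θ, g' θ))) := fun Ψ hΨ => by
    obtain ⟨C, hC⟩ := ((isCompact_Icc (a := m / 2) (b := M + m / 2)).prod
      (isCompact_Icc (a := -(M' + m / 2)) (b := M' + m / 2))).exists_bound_of_continuousOn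
      (hΨ.mono (prod_mono (fun x hx => lt_of_lt_of_le (by positivity) hx.1) (subset_univ _)))
    refine intervalIntegral.tendsto_integral_filter_of_dominated_convergence (fun _ => C)
      (.of_forall fun n => Continuous.aestronglyMeasurable ?_)
      (.of_forall fun n => .of_forall fun θ hθ => ?_) intervalIntegrable_const
      (.of_forall fun θ _ => ?_)
    · exact hΨ.comp_continuous ((hcont n 0).prodMk (hcont n 1)) fun θ =>
        ⟨lt_of_lt_of_le (by positivity) (hlow n θ), mem_univ _⟩
    · rw [uIoc_of_le hpi.le] at hθ
      exact hC _ ⟨hb0 n θ (Ioc_subset_Icc_self hθ), hb1 n θ (Ioc_subset_Icc_self hθ)⟩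
    · have hat : ContinuousAt Ψ (g θ, g' θ) :=
        hΨ.continuousAt ((isOpen_Ioi.prod isOpen_univ).mem_nhds ⟨hpos θ, mem_univ _⟩)
      exact hat.tendsto.comp ((ht0 θ).prodMk_nhds (ht1 θ))
  have hL := hlim (fun x => 2 * (x.1 * log x.1) - x.2 ^ 2 / x.1) (by
    have hne : ∀ x ∈ Ioi (0 : ℝ) ×ˢ (univ : Set ℝ), x.1 ≠ 0 := fun x hx => (hx.1 : 0 < x.1).ne'
    fun_prop (disch := exact hne))
  have hR := hlim (fun x => x.1) continuousOn_fst
  have hI : 0 < ∫ θ in (0 : ℝ)..2 * π, g θ :=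
    intervalIntegral_pos_of_pos (hgc.intervalIntegrable _ _) hpos hpi
  refine le_of_tendsto_of_tendsto' hL ((hR.mul (Tendsto.log (hR.const_mul (2 * π)⁻¹)
    (by positivity))).const_mul 2) fun n => ?_
  exact trigFlow_logSobolev (s n) (c n) (by positivity : 0 < m / 2) (hlow n)

end trigApprox

section convex

/-- The logarithmic Sobolev inequality for `u ^ Q`, integrated by parts against a supersolution. -/
theorem neg_entropy_le_integral {u u' u'' v : ℝ → ℝ} {Q : ℝ} (hQ : 1 < Q)
    (hpos : ∀ θ, 0 < u θ) (hu : ∀ θ, HasDerivAt u (u' θ) θ) (hu' : ∀ θ, HasDerivAt u' (u'' θ) θ)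
    (hu'' : Continuous u'') (hper : Function.Periodic u (2 * π)) (hv : Continuous v)
    (huv : ∀ θ, 0 ≤ v θ + u'' θ) :
    -(2 * (Q - 1)) * ((∫ θ in (0 : ℝ)..2 * π, u θ ^ Q) *
      log ((2 * π)⁻¹ * ∫ θ in (0 : ℝ)..2 * π, u θ ^ Q)) ≤
    ∫ θ in (0 : ℝ)..2 * π, Q * (u θ ^ Q * (-(2 * (Q - 1)) * log (u θ) + Q * v θ / u θ)) := by
  have cu : Continuous u := continuous_iff_continuousAt.2 fun θ => (hu θ).continuousAt
  have cu' : Continuous u' := continuous_iff_continuousAt.2 fun θ => (hu' θ).continuousAt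
  have hne : ∀ θ, u θ ≠ 0 := fun θ => (hpos θ).ne'
  have hgpos : ∀ θ, 0 < u θ ^ Q := fun θ => rpow_pos_of_pos (hpos θ) Q
  have hgne : ∀ θ, u θ ^ Q ≠ 0 := fun θ => (hgpos θ).ne'
  have cg : Continuous fun θ => u θ ^ Q := cu.rpow_const fun θ => .inl (hne θ)
  have cl : Continuous fun θ => log (u θ) := cu.log hne
  have clg : Continuous fun θ => log (u θ ^ Q) := cg.log hgne
  have hper' : u' (2 * π) = u' 0 := by
    have h1 : HasDerivAt u (u' (0 + 2 * π)) 0 := by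
      have := (hu (0 + 2 * π)).comp_add_const 0 (2 * π)
      rwa [funext hper] at this
    simpa using h1.unique (hu 0)
  have hg : ∀ θ, HasDerivAt (fun θ => u θ ^ Q) (Q * u θ ^ Q * u' θ / u θ) θ := fun θ => by
    refine ((hu θ).rpow_const (.inl (hne θ))).congr_deriv ?_
    rw [rpow_sub_one (hne θ)]
    ring
  have cg' : Continuous fun θ => Q * u θ ^ Q * u' θ / u θ := by fun_prop (disch := simp)
  have hLS := circle_logSobolev hg cg' (fun θ => by simp only [hper θ]) hgpos
  let φ : ℝ → ℝ := fun θ => (Q - 1) * u θ ^ Q * u' θ ^ 2 / u θ ^ 2 + u θ ^ Q * u'' θ / u θ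
  have cφ : Continuous φ := by
    simp only [φ]
    fun_prop (disch := simp [hne])
  have hφ : ∫ θ in (0 : ℝ)..2 * π, φ θ = 0 := by
    have hΦ : ∀ θ, HasDerivAt (fun θ => u θ ^ Q * u' θ / u θ) (φ θ) θ := fun θ => by
      refine (((hg θ).mul (hu' θ)).div (hu θ) (hne θ)).congr_deriv ?_
      have := hne θ
      simp only [φ, Pi.mul_apply]
      field_simp
      ring
    rw [integral_eq_sub_of_hasDerivAt (fun θ _ => hΦ θ) (cφ.intervalIntegrable _ _), hper', hper.eq,
      sub_self]
  have hle : ∫ θ in (0 : ℝ)..2 * π, (-(Q - 1) * (2 * (u θ ^ Q * log (u θ ^ Q))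
      - (Q * u θ ^ Q * u' θ / u θ) ^ 2 / u θ ^ Q) - Q ^ 2 * φ θ) ≤
      ∫ θ in (0 : ℝ)..2 * π, Q * (u θ ^ Q * (-(2 * (Q - 1)) * log (u θ) + Q * v θ / u θ)) := by
    refine integral_mono_on (by positivity)
      (Continuous.intervalIntegrable (by fun_prop (disch := simp)) _ _)
      (Continuous.intervalIntegrable (by fun_prop (disch := simp)) _ _) fun θ _ => ?_
    rw [log_rpow (hpos θ), ← sub_nonneg]
    have h : 0 ≤ Q ^ 2 * (u θ ^ Q / u θ) * (v θ + u'' θ) :=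
      mul_nonneg (mul_nonneg (sq_nonneg _) (div_pos (hgpos θ) (hpos θ)).le) (huv θ)
    refine h.trans_eq ?_
    have h1 := hne θ
    have h2 := hgne θ
    simp only [φ]
    field_simp
    ring
  refine le_trans ?_ hle
  rw [intervalIntegral.integral_sub
    (Continuous.intervalIntegrable (by fun_prop (disch := simp)) _ _)
    (Continuous.intervalIntegrable (by fun_prop) _ _), intervalIntegral.integral_const_mul,
    intervalIntegral.integral_const_mul, hφ]
  have : 0 < Q - 1 := by linarith
  nlinarith

theorem ConvexOn.fderiv_fderiv_nonneg {E : Type*} [NormedAddCommGroup E] [NormedSpace ℝ E]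
    {f : E → ℝ} (hf : ContDiff ℝ 2 f) (hconv : ConvexOn ℝ univ f) (z v : E) :
    0 ≤ fderiv ℝ (fderiv ℝ f) z v v := by
  have hline : ∀ t : ℝ, HasDerivAt (fun t : ℝ => z + t • v) v t := fun t => by
    simpa using ((hasDerivAt_id t).smul_const v).const_add z
  have h1 : ∀ t : ℝ, HasDerivAt (fun t : ℝ => f (z + t • v)) (fderiv ℝ f (z + t • v) v) t :=
    fun t => ((hf.differentiable (by norm_num) _).hasFDerivAt).comp_hasDerivAt t (hline t)
  have hf' : ContDiff ℝ 1 (fderiv ℝ f) := hf.fderiv_right (by norm_num)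
  have h2 : HasDerivAt (fun t : ℝ => fderiv ℝ f (z + t • v) v) (fderiv ℝ (fderiv ℝ f) z v v) 0 := by
    have h := ((hf'.differentiable (by norm_num) (z + (0 : ℝ) • v)).hasFDerivAt).comp_hasDerivAt 0
      (hline 0)
    simpa using h.clm_apply (hasDerivAt_const 0 v)
  have hc : ConvexOn ℝ univ fun t : ℝ => f (z + t • v) := by
    have := hconv.comp_affineMap (AffineMap.lineMap z (z + v) : ℝ →ᵃ[ℝ] E)
    simpa [Function.comp_def, AffineMap.lineMap_apply, add_comm] using this
  have hmono := hc.monotoneOn_deriv fun t _ => (h1 t).differentiableAt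
  rw [funext fun t => (h1 t).deriv, monotoneOn_univ] at hmono
  rw [← h2.deriv]
  exact hmono.deriv_nonneg

/-- Monotonicity of the `L^(1 + (p - 1) / s ^ 2)` mean in the radius `s` for subharmonic-type flows. -/
theorem rpow_mean_le_of_supersolution {u us u' u'' : ℝ → ℝ → ℝ}
    (cu : Continuous (Function.uncurry u)) (cus : Continuous (Function.uncurry us))
    (cu'' : Continuous (Function.uncurry u'')) (hpos : ∀ s θ, 0 < u s θ)
    (hus : ∀ s θ, HasDerivAt (fun s => u s θ) (us s θ) s)
    (hu : ∀ s θ, HasDerivAt (u s) (u' s θ) θ) (hu' : ∀ s θ, HasDerivAt (u' s) (u'' s θ) θ)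
    (hper : ∀ s, Function.Periodic (u s) (2 * π)) (hsuper : ∀ s θ, 0 ≤ s * us s θ + u'' s θ)
    {p r : ℝ} (hp : 1 < p) (hr0 : 0 < r) (hr1 : r ≤ 1) :
    ((2 * π)⁻¹ * ∫ θ in (0 : ℝ)..2 * π, u r θ ^ (1 + (p - 1) / r ^ 2))
      ^ (1 / (1 + (p - 1) / r ^ 2)) ≤
    ((2 * π)⁻¹ * ∫ θ in (0 : ℝ)..2 * π, u 1 θ ^ p) ^ (1 / p) := by
  have hpi : 0 < 2 * π := by positivity
  let Q : ℝ → ℝ := fun s => 1 + (p - 1) / s ^ 2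
  let Q' : ℝ → ℝ := fun s => -(2 * (p - 1)) / s ^ 3
  have hQ1 : ∀ s, 0 < s → 1 < Q s := fun s hs => by
    have : 0 < (p - 1) / s ^ 2 := div_pos (by linarith) (by positivity)
    simp only [Q]
    linarith
  have hQd : ∀ s, 0 < s → HasDerivAt Q (Q' s) s := fun s hs => by
    refine ((((hasDerivAt_pow 2 s).fun_inv (by positivity)).const_mul (p - 1)).const_add 1).congr_deriv ?_
    simp only [Q']
    field_simp
    ring
  have hQQ' : ∀ s, 0 < s → s * Q' s = -(2 * (Q s - 1)) := fun s hs => by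
    simp only [Q, Q']
    field_simp
    ring
  have cQ : ContinuousOn Q (Ioi 0) := fun s hs => (hQd s hs).continuousAt.continuousWithinAt
  have cQ' : ContinuousOn Q' (Ioi 0) :=
    continuousOn_const.div (by fun_prop) fun s (hs : 0 < s) => by positivity
  have cQ1 : ContinuousOn (fun x : ℝ × ℝ => Q x.1) (Ioi 0 ×ˢ univ) :=
    cQ.comp continuousOn_fst fun x hx => hx.1
  have cQ1' : ContinuousOn (fun x : ℝ × ℝ => Q' x.1) (Ioi 0 ×ˢ univ) :=
    cQ'.comp continuousOn_fst fun x hx => hx.1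
  have hQ1s : Q 1 = p := by simp [Q]
  have hne : ∀ x : ℝ × ℝ, Function.uncurry u x ≠ 0 := fun x => (hpos _ _).ne'
  let G' : ℝ → ℝ → ℝ := fun s θ =>
    u s θ ^ Q s * (Q' s * log (u s θ) + Q s * us s θ / u s θ)
  have cu1 : ∀ s, Continuous (u s) := fun s => cu.uncurry_left s
  have cG : ∀ s, Continuous fun θ => u s θ ^ Q s := fun s =>
    (cu1 s).rpow_const fun θ => .inl (hpos s θ).ne'
  have cG' : ContinuousOn (Function.uncurry G') (Ioi 0 ×ˢ univ) :=
    (cu.continuousOn.rpow cQ1 fun x _ => .inl (hne x)).mul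
      ((cQ1'.mul (cu.log hne).continuousOn).add
        ((cQ1.mul cus.continuousOn).div cu.continuousOn fun x _ => hne x))
  let M : ℝ → ℝ := fun s => ∫ θ in (0 : ℝ)..2 * π, u s θ ^ Q s
  have hMpos : ∀ s, 0 < M s := fun s => intervalIntegral_pos_of_pos
    ((cG s).intervalIntegrable _ _) (fun θ => rpow_pos_of_pos (hpos s θ) _) hpi
  have hM : ∀ s, 0 < s → HasDerivAt M (∫ θ in (0 : ℝ)..2 * π, G' s θ) s := fun s hs => by
    refine hasDerivAt_intervalIntegral_of_continuousOn isOpen_Ioi hs (fun s _ => cG s) cG'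
      fun s hs θ => ?_
    refine ((hus s θ).rpow (hQd s hs) (hpos s θ)).congr_deriv ?_
    simp only [G']
    rw [rpow_sub_one (hpos s θ).ne']
    ring
  let J : ℝ → ℝ := fun s => log ((2 * π)⁻¹ * M s) / Q s
  have hJ : ∀ s, 0 < s → HasDerivAt J ((((2 * π)⁻¹ * ∫ θ in (0 : ℝ)..2 * π, G' s θ) /
      ((2 * π)⁻¹ * M s) * Q s - log ((2 * π)⁻¹ * M s) * Q' s) / Q s ^ 2) s := fun s hs =>
    (((hM s hs).const_mul (2 * π)⁻¹).log (by have := hMpos s; positivity)).div (hQd s hs)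
      (by linarith [hQ1 s hs])
  have hJ0 : ∀ s, 0 < s → 0 ≤ deriv J s := fun s hs => by
    rw [(hJ s hs).deriv]
    refine div_nonneg ?_ (sq_nonneg _)
    have h := neg_entropy_le_integral (v := fun θ => s * us s θ) (hQ1 s hs) (hpos s) (hu s) (hu' s)
      (cu''.uncurry_left s)
      (hper s) (continuous_const.mul (cus.uncurry_left s))
      (hsuper s)
    have hI : ∫ θ in (0 : ℝ)..2 * π, Q s * (u s θ ^ Q s *
        (-(2 * (Q s - 1)) * log (u s θ) + Q s * (s * us s θ) / u s θ))
        = Q s * s * ∫ θ in (0 : ℝ)..2 * π, G' s θ := by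
      rw [← intervalIntegral.integral_const_mul]
      refine intervalIntegral.integral_congr fun θ _ => ?_
      simp only [G']
      rw [← hQQ' s hs]
      ring
    rw [hI, ← hQQ' s hs] at h
    change s * Q' s * (M s * log ((2 * π)⁻¹ * M s)) ≤ _ at h
    have hm := hMpos s
    rw [mul_div_mul_left _ _ (inv_ne_zero hpi.ne'), div_mul_eq_mul_div, sub_nonneg,
      le_div_iff₀ hm]
    refine le_of_mul_le_mul_left ?_ hs
    linarith
  have hmono : MonotoneOn J (Ioi 0) := by
    refine monotoneOn_of_deriv_nonneg (convex_Ioi 0)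
      (fun s hs => (hJ s hs).continuousAt.continuousWithinAt) ?_ ?_ <;> rw [interior_Ioi]
    · exact fun s hs => (hJ s hs).differentiableAt.differentiableWithinAt
    · exact hJ0
  have hfin := exp_le_exp.2 (hmono hr0 (zero_lt_one : (0 : ℝ) < 1) hr1)
  have hexp : ∀ s, exp (J s) = ((2 * π)⁻¹ * M s) ^ (1 / Q s) := fun s => by
    rw [rpow_def_of_pos (by have := hMpos s; positivity), mul_one_div]
  rw [hexp, hexp] at hfin
  simp only [M, hQ1s] at hfin
  exact hfin

/-- Hypercontractivity on the circle for smooth positive convex functions of the plane. -/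
theorem hypercontractive_of_convex_contDiff {f : ℂ → ℝ} (hf : ContDiff ℝ 2 f)
    (hconv : ConvexOn ℝ univ f) (hpos : ∀ z, 0 < f z) {p r : ℝ} (hp : 1 < p) (hr0 : 0 < r)
    (hr1 : r ≤ 1) :
    ((2 * π)⁻¹ * ∫ θ in (0 : ℝ)..2 * π, f (r * Complex.exp (θ * Complex.I)) ^ (1 + (p - 1) / r ^ 2))
      ^ (1 / (1 + (p - 1) / r ^ 2)) ≤
    ((2 * π)⁻¹ * ∫ θ in (0 : ℝ)..2 * π, f (Complex.exp (θ * Complex.I)) ^ p) ^ (1 / p) := by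
  let z : ℝ → ℝ → ℂ := fun s θ => s * Complex.exp (θ * Complex.I)
  let u : ℝ → ℝ → ℝ := fun s θ => f (z s θ)
  let us : ℝ → ℝ → ℝ := fun s θ => fderiv ℝ f (z s θ) (Complex.exp (θ * Complex.I))
  let u' : ℝ → ℝ → ℝ := fun s θ => fderiv ℝ f (z s θ) (z s θ * Complex.I)
  let u'' : ℝ → ℝ → ℝ := fun s θ => fderiv ℝ (fderiv ℝ f) (z s θ) (z s θ * Complex.I)
    (z s θ * Complex.I) + fderiv ℝ f (z s θ) (-(z s θ))
  have hf1 : ContDiff ℝ 1 (fderiv ℝ f) := hf.fderiv_right (by norm_num)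
  have cf : Continuous f := hf.continuous
  have cf1 : Continuous (fderiv ℝ f) := hf1.continuous
  have cf2 : Continuous (fderiv ℝ (fderiv ℝ f)) := hf1.continuous_fderiv (by norm_num)
  have cz : Continuous (Function.uncurry z) := by
    simp only [z, Function.uncurry_def]
    fun_prop
  have hzθ : ∀ s θ, HasDerivAt (z s) (z s θ * Complex.I) θ := fun s θ => by
    have h : HasDerivAt (fun w : ℂ => (s : ℂ) * Complex.exp (w * Complex.I))
        (z s θ * Complex.I) θ :=
      ((((hasDerivAt_id (θ : ℂ)).mul_const Complex.I).cexp).const_mul (s : ℂ)).congr_deriv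
        (by simp [z]; ring)
    exact h.comp_ofReal
  have hzs : ∀ s θ, HasDerivAt (fun s => z s θ) (Complex.exp (θ * Complex.I)) s := fun s θ => by
    have h : HasDerivAt (fun w : ℂ => w * Complex.exp (θ * Complex.I))
        (Complex.exp (θ * Complex.I)) (s : ℂ) := by
      simpa using (hasDerivAt_id (s : ℂ)).mul_const (Complex.exp (θ * Complex.I))
    exact h.comp_ofReal
  have hu : ∀ s θ, HasDerivAt (u s) (u' s θ) θ := fun s θ =>
    ((hf.differentiable (by norm_num) _).hasFDerivAt).comp_hasDerivAt θ (hzθ s θ)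
  have hus : ∀ s θ, HasDerivAt (fun s => u s θ) (us s θ) s := fun s θ =>
    ((hf.differentiable (by norm_num) _).hasFDerivAt).comp_hasDerivAt s (hzs s θ)
  have hu' : ∀ s θ, HasDerivAt (u' s) (u'' s θ) θ := fun s θ => by
    have h := ((hf1.differentiable (by norm_num) (z s θ)).hasFDerivAt).comp_hasDerivAt θ (hzθ s θ)
    refine (h.clm_apply ((hzθ s θ).mul_const Complex.I)).congr_deriv ?_
    simp [u'', mul_assoc]
  have hconvex : ∀ s θ, 0 ≤ s * us s θ + u'' s θ := fun s θ => by
    have h := ConvexOn.fderiv_fderiv_nonneg hf hconv (z s θ) (z s θ * Complex.I)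
    have h2 : s * us s θ = fderiv ℝ f (z s θ) (z s θ) := by
      rw [← smul_eq_mul, ← map_smul]
      simp [z]
    rw [h2]
    simpa [u''] using h
  have cu : Continuous (Function.uncurry u) := cf.comp cz
  have cus : Continuous (Function.uncurry us) := (cf1.comp cz).clm_apply (by fun_prop)
  have czI : Continuous fun x : ℝ × ℝ => z x.1 x.2 * Complex.I := cz.mul continuous_const
  have cu'' : Continuous (Function.uncurry u'') :=
    (((cf2.comp cz).clm_apply czI).clm_apply czI).add ((cf1.comp cz).clm_apply cz.neg)
  have hper : ∀ s, Function.Periodic (u s) (2 * π) := fun s θ => by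
    simp only [u, z]
    congr 2
    push_cast
    rw [add_mul, Complex.exp_periodic]
  have h := rpow_mean_le_of_supersolution cu cus cu'' (fun s θ => hpos _) hus hu hu' hper hconvex
    hp hr0 hr1
  simpa [u, z] using h

end convex

/-- Convolution with a bump function regularizes a nonnegative convex function uniformly. -/
theorem ConvexOn.exists_contDiff_near {N : ℂ → ℝ} (hN : ConvexOn ℝ univ N)
    (hu : UniformContinuous N) (hnn : ∀ z, 0 ≤ N z) {ε : ℝ} (hε : 0 < ε) :
    ∃ f : ℂ → ℝ, ContDiff ℝ 2 f ∧ ConvexOn ℝ univ f ∧ (∀ z, 0 < f z) ∧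
      ∀ z, |f z - N z| ≤ ε := by
  obtain ⟨δ, hδ, hNδ⟩ := Metric.uniformContinuous_iff.1 hu (ε / 2) (by positivity)
  let φ : ContDiffBump (0 : ℂ) := ⟨δ / 2, δ, by positivity, by linarith⟩
  let g : ℂ → ℝ := convolution (φ.normed volume) N (ContinuousLinearMap.lsmul ℝ ℝ) volume
  have hg (z : ℂ) : g z = ∫ t, φ.normed volume t * N (z - t) := rfl
  have hint (z : ℂ) : Integrable fun t ↦ φ.normed volume t * N (z - t) := by
    refine Continuous.integrable_of_hasCompactSupport ?_ ?_
    · exact φ.continuous_normed.mul (hu.continuous.comp (by fun_prop))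
    · exact φ.hasCompactSupport_normed.mul_right
  refine ⟨fun z ↦ g z + ε / 2, ?_, ⟨convex_univ, ?_⟩, ?_, ?_⟩
  · refine ContDiff.add ?_ contDiff_const
    exact φ.hasCompactSupport_normed.contDiff_convolution_left (n := 2) _
      φ.contDiff_normed hu.continuous.locallyIntegrable
  · intro z _ w _ a b ha hb hab
    have key : g (a • z + b • w) ≤ a * g z + b * g w := by
      rw [hg, hg, hg, ← MeasureTheory.integral_const_mul, ← MeasureTheory.integral_const_mul,
        ← MeasureTheory.integral_add ((hint z).const_mul a) ((hint w).const_mul b)]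
      refine MeasureTheory.integral_mono (hint _) (((hint z).const_mul a).add
        ((hint w).const_mul b)) fun t ↦ ?_
      have h1 := hN.2 (mem_univ (z - t)) (mem_univ (w - t)) ha hb hab
      have h2 : a • (z - t) + b • (w - t) = a • z + b • w - t := by
        rw [smul_sub, smul_sub, sub_add_sub_comm, ← add_smul, hab, one_smul]
      rw [h2, smul_eq_mul, smul_eq_mul] at h1
      have h3 := mul_le_mul_of_nonneg_left h1 (φ.nonneg_normed (μ := volume) t)
      simp only
      linarith
    simp only [smul_eq_mul]
    linear_combination key - ε / 2 * hab
  · intro z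
    have : 0 ≤ g z := by
      rw [hg]
      exact MeasureTheory.integral_nonneg fun t ↦ mul_nonneg (φ.nonneg_normed t) (hnn _)
    positivity
  · intro z
    have h := φ.dist_normed_convolution_le (μ := volume) (x₀ := z) (ε := ε / 2)
      hu.continuous.aestronglyMeasurable fun w hw ↦ (hNδ hw).le
    rw [Real.dist_eq] at h
    change |g z - N z| ≤ ε / 2 at h
    rw [abs_le] at h ⊢
    constructor <;> linarith

/-- Power means over the circle are continuous under uniform convergence. -/
theorem tendsto_rpow_mean {g : ℕ → ℝ → ℝ} {h : ℝ → ℝ} (hg : ∀ n, Continuous (g n))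
    (hh : Continuous h) (hg0 : ∀ n θ, 0 ≤ g n θ)
    (hgh : ∀ n θ, |g n θ - h θ| ≤ 1 / ((n : ℝ) + 1)) {s : ℝ} (hs : 0 < s) :
    Filter.Tendsto
      (fun n ↦ ((2 * π)⁻¹ * ∫ θ in (0 : ℝ)..2 * π, g n θ ^ s) ^ (1 / s)) Filter.atTop
      (nhds (((2 * π)⁻¹ * ∫ θ in (0 : ℝ)..2 * π, h θ ^ s) ^ (1 / s))) := by
  have hpt (θ : ℝ) : Filter.Tendsto (fun n ↦ g n θ) Filter.atTop (nhds (h θ)) := by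
    rw [tendsto_iff_dist_tendsto_zero]
    refine squeeze_zero (fun n ↦ dist_nonneg) (fun n ↦ ?_) tendsto_one_div_add_atTop_nhds_zero_nat
    rw [Real.dist_eq]
    exact hgh n θ
  refine Filter.Tendsto.rpow_const (Filter.Tendsto.const_mul _ ?_) (Or.inr (by positivity))
  refine intervalIntegral.tendsto_integral_filter_of_dominated_convergence
    (fun θ ↦ (|h θ| + 1) ^ s) ?_ ?_ ?_ ?_
  · exact .of_forall fun n ↦
      ((hg n).rpow_const fun _ ↦ Or.inr hs.le).aestronglyMeasurable
  · refine .of_forall fun n ↦ .of_forall fun θ _ ↦ ?_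
    rw [Real.norm_of_nonneg (rpow_nonneg (hg0 n θ) s)]
    refine rpow_le_rpow (hg0 n θ) ?_ hs.le
    have h1 := (abs_le.1 (hgh n θ)).2
    have h2 : 1 / ((n : ℝ) + 1) ≤ 1 := by
      rw [div_le_one (by positivity)]
      linarith [n.cast_nonneg (α := ℝ)]
    linarith [le_abs_self (h θ)]
  · exact ((hh.abs.add continuous_const).rpow_const fun _ ↦ Or.inr hs.le).intervalIntegrable _ _
  · exact .of_forall fun θ _ ↦ (hpt θ).rpow_const (Or.inr hs.le)

/-- Hypercontractivity on the circle for nonnegative convex functions of the plane. -/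
theorem ConvexOn.hypercontractive {N : ℂ → ℝ} (hN : ConvexOn ℝ univ N)
    (hu : UniformContinuous N) (hnn : ∀ z, 0 ≤ N z) {p r : ℝ} (hp : 1 < p) (hr0 : 0 < r)
    (hr1 : r ≤ 1) :
    ((2 * π)⁻¹ * ∫ θ in (0 : ℝ)..2 * π,
        N (r * Complex.exp (θ * Complex.I)) ^ (1 + (p - 1) / r ^ 2))
      ^ (1 / (1 + (p - 1) / r ^ 2)) ≤
    ((2 * π)⁻¹ * ∫ θ in (0 : ℝ)..2 * π, N (Complex.exp (θ * Complex.I)) ^ p) ^ (1 / p) := by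
  choose f hf hfc hfp hfN using fun n : ℕ ↦
    hN.exists_contDiff_near hu hnn (ε := 1 / ((n : ℝ) + 1)) (by positivity)
  have hq : 0 < 1 + (p - 1) / r ^ 2 := by
    have := div_nonneg (sub_nonneg.2 hp.le) (sq_nonneg r)
    linarith
  refine le_of_tendsto_of_tendsto'
    (tendsto_rpow_mean (g := fun n θ ↦ f n (r * Complex.exp (θ * Complex.I)))
      (fun n ↦ (hf n).continuous.comp (by fun_prop)) (hu.continuous.comp (by fun_prop))
      (fun n θ ↦ (hfp n _).le) (fun n θ ↦ hfN n _) hq)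
    (tendsto_rpow_mean (g := fun n θ ↦ f n (Complex.exp (θ * Complex.I)))
      (fun n ↦ (hf n).continuous.comp (by fun_prop)) (hu.continuous.comp (by fun_prop))
      (fun n θ ↦ (hfp n _).le) (fun n θ ↦ hfN n _) (by linarith)) fun n ↦ ?_
  exact hypercontractive_of_convex_contDiff (hf n) (hfc n) (hfp n) hp hr0 hr1

/-- Power means over the circle increase with the exponent. -/
theorem rpow_mean_le_rpow_mean {h : ℝ → ℝ} (hh : Continuous h) (h0 : ∀ θ, 0 ≤ h θ)
    {s t : ℝ} (hs : 0 < s) (hst : s ≤ t) :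
    ((2 * π)⁻¹ * ∫ θ in (0 : ℝ)..2 * π, h θ ^ s) ^ (1 / s) ≤
      ((2 * π)⁻¹ * ∫ θ in (0 : ℝ)..2 * π, h θ ^ t) ^ (1 / t) := by
  have ht : 0 < t := hs.trans_le hst
  have hcs : Continuous fun θ ↦ h θ ^ s := hh.rpow_const fun _ ↦ Or.inr hs.le
  have hct : Continuous fun θ ↦ h θ ^ t := hh.rpow_const fun _ ↦ Or.inr ht.le
  have hpow (θ : ℝ) : (h θ ^ s) ^ (t / s) = h θ ^ t := by
    rw [← rpow_mul (h0 θ), mul_div_cancel₀ _ hs.ne']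
  have hpi : (0 : ℝ) ≤ 2 * π := by positivity
  have hJ := (convexOn_rpow ((one_le_div hs).2 hst)).map_set_average_le (μ := volume)
    (t := uIoc 0 (2 * π)) (f := fun θ ↦ h θ ^ s)
    (continuous_id.rpow_const fun _ ↦ Or.inr (div_pos ht hs).le).continuousOn isClosed_Ici
    (by simp [uIoc_of_le hpi, pi_pos]) (by rw [uIoc_of_le hpi]; exact measure_Ioc_lt_top.ne)
    (.of_forall fun θ ↦ rpow_nonneg (h0 θ) s)
    (by rw [uIoc_of_le hpi]; exact (hcs.intervalIntegrable 0 (2 * π)).1)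
    (by
      rw [uIoc_of_le hpi]
      refine ((hct.intervalIntegrable 0 (2 * π)).1).congr_fun (fun θ _ ↦ (hpow θ).symm) ?_
      exact measurableSet_Ioc)
  simp only [hpow] at hJ
  rw [interval_average_eq, interval_average_eq, sub_zero, smul_eq_mul, smul_eq_mul] at hJ
  have hA : 0 ≤ (2 * π)⁻¹ * ∫ θ in (0 : ℝ)..2 * π, h θ ^ s :=
    mul_nonneg (by positivity)
      (intervalIntegral.integral_nonneg hpi fun θ _ ↦ rpow_nonneg (h0 θ) s)
  calc _ = (((2 * π)⁻¹ * ∫ θ in (0 : ℝ)..2 * π, h θ ^ s) ^ (t / s)) ^ (1 / t) := by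
        rw [← rpow_mul hA]
        congr 1
        field_simp
    _ ≤ _ := rpow_le_rpow (rpow_nonneg hA _) hJ (by positivity)

end

/-- The complex hypercontractive inequality for norms: if `1 < p < q < ∞` and
`0 < r ≤ √((p−1)/(q−1))`, then for every complex Banach space `X` and all `x, y ∈ X`,
`((1/(2π))∫₀^{2π}‖x + r·e^{iθ}y‖^q dθ)^{1/q} ≤ ((1/(2π))∫₀^{2π}‖x + e^{iθ}y‖^p dθ)^{1/p}`. -/
theorem complex_hypercontractive_inequality
    (p q r : ℝ) (hp : 1 < p) (hpq : p < q)
    (hr0 : 0 < r) (hr : r ≤ Real.sqrt ((p - 1) / (q - 1)))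
    (X : Type*) [NormedAddCommGroup X] [NormedSpace ℂ X] [CompleteSpace X] (x y : X) :
    ((1 / (2 * Real.pi)) *
        ∫ θ in (0:ℝ)..(2 * Real.pi), ‖x + ((r : ℂ) * Complex.exp (θ * Complex.I)) • y‖ ^ q) ^ (1 / q) ≤
      ((1 / (2 * Real.pi)) *
        ∫ θ in (0:ℝ)..(2 * Real.pi), ‖x + Complex.exp (θ * Complex.I) • y‖ ^ p) ^ (1 / p) := by
  have hq1 : 0 < q - 1 := by linarith
  have hr2 : r ^ 2 ≤ (p - 1) / (q - 1) := by
    rwa [← Real.le_sqrt hr0.le (div_nonneg (by linarith) hq1.le)]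
  have hle : 1 + r ^ 2 * (q - 1) ≤ p := by
    have := (le_div_iff₀ hq1).1 hr2
    linarith
  have hlt : 1 < 1 + r ^ 2 * (q - 1) := by
    have : 0 < r ^ 2 * (q - 1) := by positivity
    linarith
  have hr1 : r ≤ 1 := by
    have h1 : (p - 1) / (q - 1) ≤ 1 := (div_le_one hq1).2 (by linarith)
    nlinarith
  have hexp : 1 + (1 + r ^ 2 * (q - 1) - 1) / r ^ 2 = q := by
    field_simp
    ring
  have hconv : ConvexOn ℝ Set.univ fun z : ℂ ↦ ‖x + z • y‖ := by
    refine ⟨convex_univ, fun z _ w _ a b ha hb hab ↦ ?_⟩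
    have hsum : x + (a • z + b • w) • y = a • (x + z • y) + b • (x + w • y) := by
      rw [smul_add, smul_add, add_smul, smul_assoc, smul_assoc, add_add_add_comm, ← add_smul,
        hab, one_smul]
    simp only [hsum, smul_eq_mul]
    refine (norm_add_le _ _).trans_eq ?_
    rw [norm_smul, norm_smul, Real.norm_of_nonneg ha, Real.norm_of_nonneg hb]
  have hlip : LipschitzWith ‖y‖₊ fun z : ℂ ↦ ‖x + z • y‖ := by
    refine LipschitzWith.of_dist_le_mul fun z w ↦ ?_
    rw [Real.dist_eq, dist_eq_norm, coe_nnnorm, mul_comm, ← norm_smul, sub_smul]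
    exact (abs_norm_sub_norm_le _ _).trans_eq (by rw [add_sub_add_left_eq_sub])
  have key := hconv.hypercontractive hlip.uniformContinuous (fun _ ↦ norm_nonneg _) hlt hr0 hr1
  rw [hexp] at key
  rw [one_div (2 * Real.pi)]
  exact key.trans (rpow_mean_le_rpow_mean (by fun_prop) (fun _ ↦ norm_nonneg _)
    (by linarith) hle)
end
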